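/- For the urn process with b(i) = w(2i+1) and r(i) = w(2i) (the '+'-urn), the expected discrepancy at blue-draw times converges: lim_{n→∞} E[𝔇_{τ_n^𝔅}] = 1/(2(2α+1)). -/

import Mathlib

open MeasureTheory ProbabilityTheory Filter

/-- The asymptotic condition `1/w(n) = n^α (1 + 2B/n + O(1/n²))` on the weight function. -/
def WeightAsymp (w : ℕ → ℝ) (α B : ℝ) : Prop :=
  ∃ C₀ > (0:ℝ), ∃ N₀ : ℕ, ∀ n : ℕ, N₀ ≤ n →
    |1 / w n - (n:ℝ) ^ α - 2 * B * (n:ℝ) ^ (α - 1)| ≤ C₀ * (n:ℝ) ^ (α - 2)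

/-- The three admissible choices of `(b, r)` in terms of the weight function `w`. -/
def UrnChoice (w b r : ℕ → ℝ) : Prop :=
  (∀ i, b i = w (2*i) ∧ r i = w (2*i+1)) ∨
  (∀ i, b i = w (2*i+1) ∧ r i = w (2*i)) ∨
  (∀ i, b i = w (2*i) ∧ r i = w (2*i))

/-- A generalized Pólya urn process: `Bl n` and `Re n` are the numbers of blue and red
balls drawn in the first `n` draws; started at `(0,0)`, exactly one coordinate increases
by `1` at each step, and conditionally on the past the blue coordinate increases with
probability `b(Bl n)/(b(Bl n) + r(Re n))`. -/
structure Urn {Ω : Type*} [MeasurableSpace Ω] (μ : Measure Ω) (b r : ℕ → ℝ) where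
  Bl : ℕ → Ω → ℕ
  Re : ℕ → Ω → ℕ
  meas_Bl : ∀ n, Measurable (Bl n)
  meas_Re : ∀ n, Measurable (Re n)
  init_Bl : ∀ ω, Bl 0 ω = 0
  init_Re : ∀ ω, Re 0 ω = 0
  step : ∀ n ω, (Bl (n+1) ω = Bl n ω + 1 ∧ Re (n+1) ω = Re n ω) ∨
                (Bl (n+1) ω = Bl n ω ∧ Re (n+1) ω = Re n ω + 1)
  markov : ∀ n : ℕ,
    μ[(fun ω => if Bl (n+1) ω = Bl n ω + 1 then (1:ℝ) else 0) |
        ⨆ j ∈ Set.Iic n, MeasurableSpace.comap (fun ω => (Bl j ω, Re j ω)) inferInstance]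
      =ᵐ[μ] fun ω => b (Bl n ω) / (b (Bl n ω) + r (Re n ω))

namespace Urn

variable {Ω : Type*} [MeasurableSpace Ω] {μ : Measure Ω} {b r : ℕ → ℝ}

/-- The discrepancy `𝔇_n = ℜ_n − 𝔅_n`. -/
def D (U : Urn μ b r) (n : ℕ) (ω : Ω) : ℤ := (U.Re n ω : ℤ) - (U.Bl n ω : ℤ)

/-- `τ_k^𝔅`, the number of draws until the `k`-th blue ball. -/
noncomputable def tau (U : Urn μ b r) : ℕ → Ω → ℕ
  | 0 => fun _ => 0
  | k+1 => fun ω => sInf {n : ℕ | U.tau k ω < n ∧ U.Bl n ω = U.Bl (n-1) ω + 1}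

/-- The natural filtration `ℱ_n = σ((𝔅_j, ℜ_j), j ≤ n)`. -/
def F (U : Urn μ b r) (n : ℕ) : MeasurableSpace Ω :=
  ⨆ j ∈ Set.Iic n, MeasurableSpace.comap (fun ω => (U.Bl j ω, U.Re j ω)) inferInstance

end Urn

/-- Sequences bounded by a polynomial. -/
@[fun_prop]
def PolyGrowth (φ : ℕ → ℝ) : Prop := ∃ C : ℝ, ∃ k : ℕ, ∀ j, |φ j| ≤ C * ((j : ℝ) + 1) ^ k

namespace PolyGrowth

theorem of_abs_le {φ ψ : ℕ → ℝ} (hψ : PolyGrowth ψ) (h : ∀ j, |φ j| ≤ ψ j) : PolyGrowth φ := by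
  obtain ⟨C, k, hC⟩ := hψ
  exact ⟨C, k, fun j => (h j).trans ((le_abs_self _).trans (hC j))⟩

@[fun_prop]
theorem const (c : ℝ) : PolyGrowth fun _ => c := ⟨|c|, 0, fun j => by simp⟩

@[fun_prop]
theorem natCast : PolyGrowth fun j => (j : ℝ) :=
  ⟨1, 1, fun j => by rw [abs_of_nonneg (Nat.cast_nonneg j)]; linarith⟩

@[fun_prop]
theorem add {φ ψ : ℕ → ℝ} (hφ : PolyGrowth φ) (hψ : PolyGrowth ψ) :
    PolyGrowth fun j => φ j + ψ j := by
  obtain ⟨C, k, hC⟩ := hφ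
  obtain ⟨D, l, hD⟩ := hψ
  refine ⟨|C| + |D|, k + l, fun j => (abs_add_le _ _).trans ?_⟩
  have h1 : (1 : ℝ) ≤ (j : ℝ) + 1 := by linarith [(Nat.cast_nonneg j : (0 : ℝ) ≤ j)]
  have hk : ((j : ℝ) + 1) ^ k ≤ ((j : ℝ) + 1) ^ (k + l) := pow_le_pow_right₀ h1 (by omega)
  have hl : ((j : ℝ) + 1) ^ l ≤ ((j : ℝ) + 1) ^ (k + l) := pow_le_pow_right₀ h1 (by omega)
  have h2 : C * ((j : ℝ) + 1) ^ k ≤ |C| * ((j : ℝ) + 1) ^ (k + l) := by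
    have := le_abs_self C
    gcongr
  have h3 : D * ((j : ℝ) + 1) ^ l ≤ |D| * ((j : ℝ) + 1) ^ (k + l) := by
    have := le_abs_self D
    gcongr
  linarith [hC j, hD j]

@[fun_prop]
theorem mul {φ ψ : ℕ → ℝ} (hφ : PolyGrowth φ) (hψ : PolyGrowth ψ) :
    PolyGrowth fun j => φ j * ψ j := by
  obtain ⟨C, k, hC⟩ := hφ
  obtain ⟨D, l, hD⟩ := hψ
  refine ⟨C * D, k + l, fun j => ?_⟩
  rw [abs_mul, pow_add]
  calc |φ j| * |ψ j| ≤ (C * ((j : ℝ) + 1) ^ k) * (D * ((j : ℝ) + 1) ^ l) :=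
        mul_le_mul (hC j) (hD j) (abs_nonneg _) ((abs_nonneg _).trans (hC j))
    _ = _ := by ring

@[fun_prop]
theorem neg {φ : ℕ → ℝ} (hφ : PolyGrowth φ) : PolyGrowth fun j => - φ j := by
  simpa using (const (-1)).mul hφ

@[fun_prop]
theorem sub {φ ψ : ℕ → ℝ} (hφ : PolyGrowth φ) (hψ : PolyGrowth ψ) :
    PolyGrowth fun j => φ j - ψ j := by
  simpa [sub_eq_add_neg] using hφ.add hψ.neg

@[fun_prop]
theorem pow {φ : ℕ → ℝ} (hφ : PolyGrowth φ) (m : ℕ) : PolyGrowth fun j => φ j ^ m := by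
  induction m with
  | zero => simpa using const 1
  | succ m ih => simpa [pow_succ] using ih.mul hφ

@[fun_prop]
theorem abs {φ : ℕ → ℝ} (hφ : PolyGrowth φ) : PolyGrowth fun j => |φ j| := by
  obtain ⟨C, k, hC⟩ := hφ
  exact ⟨C, k, fun j => by simpa using hC j⟩

@[fun_prop]
theorem div_const {φ : ℕ → ℝ} (hφ : PolyGrowth φ) (c : ℝ) : PolyGrowth fun j => φ j / c := by
  simpa [div_eq_mul_inv] using hφ.mul (const c⁻¹)

theorem sum_range {φ : ℕ → ℝ} (hφ : PolyGrowth φ) :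
    PolyGrowth fun j => ∑ k ∈ Finset.range j, φ k := by
  obtain ⟨C, k, hC⟩ := hφ
  refine ⟨|C|, k + 1, fun j => (Finset.abs_sum_le_sum_abs _ _).trans ?_⟩
  have : ∀ i ∈ Finset.range j, |φ i| ≤ |C| * ((j : ℝ) + 1) ^ k := by
    intro i hi
    have hij : (i : ℝ) ≤ j := by exact_mod_cast (Finset.mem_range.1 hi).le
    refine (hC i).trans ?_
    have := le_abs_self C
    gcongr
  refine (Finset.sum_le_card_nsmul _ _ _ this).trans ?_
  rw [Finset.card_range, nsmul_eq_mul, pow_succ]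
  have : 0 ≤ |C| * ((j : ℝ) + 1) ^ k := by positivity
  nlinarith

theorem shift {φ : ℕ → ℝ} (hφ : PolyGrowth φ) : PolyGrowth fun j => φ (j + 1) := by
  obtain ⟨C, k, hC⟩ := hφ
  refine ⟨|C| * 2 ^ k, k, fun j => (hC _).trans ?_⟩
  have := le_abs_self C
  rw [mul_assoc, ← mul_pow]
  push_cast
  gcongr
  linarith [(Nat.cast_nonneg j : (0 : ℝ) ≤ j)]

theorem rpow {φ : ℕ → ℝ} (hφ : PolyGrowth φ) (h0 : ∀ j, 0 ≤ φ j) {q : ℝ} (hq : 0 ≤ q) :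
    PolyGrowth fun j => φ j ^ q := by
  obtain ⟨m, hm⟩ := exists_nat_ge q
  refine of_abs_le (ψ := fun j => (φ j + 1) ^ m) (by fun_prop) fun j => ?_
  rw [abs_of_nonneg (Real.rpow_nonneg (h0 j) _), ← Real.rpow_natCast]
  calc φ j ^ q ≤ (φ j + 1) ^ q := Real.rpow_le_rpow (h0 j) (by linarith) hq
    _ ≤ _ := Real.rpow_le_rpow_of_exponent_le (by linarith [h0 j]) hm

theorem summable_mul {φ p : ℕ → ℝ} (hφ : PolyGrowth φ) {C : ℝ}
    (hp0 : ∀ j, 0 ≤ p j) (hp : ∀ j, p j ≤ C * (1 / 2) ^ j) : Summable fun j => p j * φ j := by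
  obtain ⟨D, k, hD⟩ := hφ
  have h1 : Summable fun j : ℕ => ((j + 1 : ℕ) : ℝ) ^ k * (1 / 2 : ℝ) ^ (j + 1) :=
    (summable_nat_add_iff (f := fun j : ℕ => (j : ℝ) ^ k * (1 / 2 : ℝ) ^ j) 1).2
      (summable_pow_mul_geometric_of_norm_lt_one k (by norm_num))
  refine Summable.of_norm_bounded (h1.mul_left (2 * C * D)) fun j => ?_
  rw [Real.norm_eq_abs, abs_mul, abs_of_nonneg (hp0 j)]
  calc p j * |φ j| ≤ (C * (1 / 2) ^ j) * (D * ((j : ℝ) + 1) ^ k) :=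
        mul_le_mul (hp j) (hD j) (abs_nonneg _) ((hp0 j).trans (hp j))
    _ = _ := by push_cast; ring

end PolyGrowth

/-- The laws `p n` of the number of red balls present at the `n`-th blue draw, characterised by
the balance equations of the urn with `b = 1 / s` and `r = 1 / ρ`. -/
structure IsHitLaw (ρ s : ℕ → ℝ) (p : ℕ → ℕ → ℝ) : Prop where
  nonneg : ∀ n j, 0 ≤ p n j
  le_one : ∀ n j, p n j ≤ 1
  init : ∀ j, p 0 j = if j = 0 then 1 else 0
  step_zero : ∀ n, p (n + 1) 0 * (1 + s n / ρ 0) = p n 0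
  step_succ : ∀ n j,
    p (n + 1) (j + 1) * (1 + s n / ρ (j + 1)) = p n (j + 1) + s n / ρ j * p (n + 1) j
  rho_pos : ∀ j, 0 < ρ j
  s_pos : ∀ n, 0 < s n
  rho_top : Tendsto ρ atTop atTop

namespace IsHitLaw

variable {ρ s : ℕ → ℝ} {p : ℕ → ℕ → ℝ}

theorem exists_geometric_bound (H : IsHitLaw ρ s p) (n : ℕ) :
    ∃ C : ℝ, ∀ j, p n j ≤ C * (1 / 2) ^ j := by
  induction n with
  | zero =>
    refine ⟨1, fun j => ?_⟩
    rw [H.init]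
    split_ifs with h
    · simp [h]
    · positivity
  | succ n ih =>
    obtain ⟨C, hC⟩ := ih
    have hC0 : 0 ≤ C := by simpa using (H.nonneg n 0).trans (hC 0)
    obtain ⟨J, hJ⟩ := eventually_atTop.1 (H.rho_top.eventually_ge_atTop (4 * s n))
    refine ⟨2 * C + 2 ^ J, fun j => ?_⟩
    have hsmall : ∀ j ≤ J, p (n + 1) j ≤ (2 * C + 2 ^ J) * (1 / 2) ^ j := by
      intro j hj
      refine (H.le_one _ _).trans ?_
      have h1 : (1 : ℝ) = 2 ^ j * (1 / 2) ^ j := by rw [← mul_pow]; norm_num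
      refine h1.le.trans ?_
      have h2 : (2 : ℝ) ^ j ≤ 2 ^ J := pow_le_pow_right₀ (by norm_num) hj
      gcongr
      linarith
    induction j with
    | zero => exact hsmall 0 (Nat.zero_le _)
    | succ j ihj =>
      by_cases hj : j + 1 ≤ J
      · exact hsmall _ hj
      have hq : s n / ρ j ≤ 1 / 4 := by
        rw [div_le_div_iff₀ (H.rho_pos j) (by norm_num)]
        linarith [hJ j (by omega)]
      have h0 : 0 ≤ p (n + 1) (j + 1) * (s n / ρ (j + 1)) :=
        mul_nonneg (H.nonneg _ _) (div_nonneg (H.s_pos n).le (H.rho_pos _).le)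
      have h1 := H.step_succ n j
      have h2 : s n / ρ j * p (n + 1) j ≤ 1 / 4 * ((2 * C + 2 ^ J) * (1 / 2) ^ j) :=
        mul_le_mul hq ihj (H.nonneg _ _) (by norm_num)
      have h3 := hC (j + 1)
      rw [pow_succ] at h3 ⊢
      have h4 : (0 : ℝ) ≤ 2 ^ J * (1 / 2) ^ j := by positivity
      nlinarith

theorem summable (H : IsHitLaw ρ s p) (n : ℕ) {φ : ℕ → ℝ} (hφ : PolyGrowth φ) :
    Summable fun j => p n j * φ j := by
  obtain ⟨C, hC⟩ := H.exists_geometric_bound n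
  exact hφ.summable_mul (H.nonneg n) hC

end IsHitLaw

/-- The mean of `φ` under the weights `p n`. -/
noncomputable def hitMean (p : ℕ → ℕ → ℝ) (n : ℕ) (φ : ℕ → ℝ) : ℝ := ∑' j, p n j * φ j

namespace IsHitLaw

variable {ρ s : ℕ → ℝ} {p : ℕ → ℕ → ℝ}

theorem mean_add (H : IsHitLaw ρ s p) (n : ℕ) {φ ψ : ℕ → ℝ} (hφ : PolyGrowth φ)
    (hψ : PolyGrowth ψ) :
    hitMean p n (fun j => φ j + ψ j) = hitMean p n φ + hitMean p n ψ := by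
  simp only [hitMean, mul_add]
  exact (H.summable n hφ).tsum_add (H.summable n hψ)

theorem mean_const_mul (n : ℕ) (c : ℝ) (φ : ℕ → ℝ) :
    hitMean p n (fun j => c * φ j) = c * hitMean p n φ := by
  simp only [hitMean, ← tsum_mul_left]
  exact tsum_congr fun j => by ring

theorem mean_mono (H : IsHitLaw ρ s p) (n : ℕ) {φ ψ : ℕ → ℝ} (hφ : PolyGrowth φ)
    (hψ : PolyGrowth ψ) (h : ∀ j, φ j ≤ ψ j) : hitMean p n φ ≤ hitMean p n ψ :=
  (H.summable n hφ).tsum_le_tsum (fun j => mul_le_mul_of_nonneg_left (h j) (H.nonneg n j))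
    (H.summable n hψ)

theorem mean_nonneg (H : IsHitLaw ρ s p) (n : ℕ) {φ : ℕ → ℝ} (h : ∀ j, 0 ≤ φ j) :
    0 ≤ hitMean p n φ :=
  tsum_nonneg fun j => mul_nonneg (H.nonneg n j) (h j)

theorem mean_sub (H : IsHitLaw ρ s p) (n : ℕ) {φ ψ : ℕ → ℝ} (hφ : PolyGrowth φ)
    (hψ : PolyGrowth ψ) :
    hitMean p n (fun j => φ j - ψ j) = hitMean p n φ - hitMean p n ψ := by
  simp only [hitMean, mul_sub]
  exact (H.summable n hφ).tsum_sub (H.summable n hψ)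

theorem abs_mean_le (H : IsHitLaw ρ s p) (n : ℕ) {φ ψ : ℕ → ℝ} (hψ : PolyGrowth ψ)
    (h : ∀ j, |φ j| ≤ ψ j) : |hitMean p n φ| ≤ hitMean p n ψ := by
  have hφ : PolyGrowth φ := hψ.of_abs_le h
  rw [abs_le]
  constructor
  · have := H.mean_mono n (φ := fun j => (-1) * ψ j) (by fun_prop) hφ
      fun j => by linarith [neg_abs_le (φ j), h j]
    rw [mean_const_mul] at this
    linarith
  · exact H.mean_mono n hφ hψ fun j => (le_abs_self _).trans (h j)

theorem mean_step (H : IsHitLaw ρ s p) (n : ℕ) {φ ψ : ℕ → ℝ} (hφ : PolyGrowth φ)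
    (hψ : PolyGrowth ψ) (h : ∀ j, φ (j + 1) = φ j + ρ j * ψ j) :
    hitMean p (n + 1) φ = hitMean p n φ + s n * hitMean p (n + 1) ψ := by
  have hinv : PolyGrowth fun j => s n / ρ j := by
    have : Tendsto (fun j => s n / ρ j) atTop (nhds 0) := H.rho_top.const_div_atTop (s n)
    obtain ⟨C, hC⟩ := this.bddAbove_range
    refine ⟨C, 0, fun j => ?_⟩
    rw [abs_of_nonneg (div_nonneg (H.s_pos n).le (H.rho_pos _).le)]
    simpa using hC ⟨j, rfl⟩
  have S1 := H.summable (n + 1) hφ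
  have S2 := H.summable (n + 1) (hinv.mul hφ)
  have S3 := H.summable (n + 1) (hinv.mul hφ.shift)
  have e1 : hitMean p n φ = (∑' j, p (n + 1) j * φ j) + (∑' j, p (n + 1) j * (s n / ρ j * φ j))
      - ∑' j, p (n + 1) j * (s n / ρ j * φ (j + 1)) := by
    have S12 := S1.add S2
    rw [hitMean, (H.summable n hφ).tsum_eq_zero_add, ← S1.tsum_add S2, S12.tsum_eq_zero_add,
      add_sub_assoc, ← ((summable_nat_add_iff 1).2 S12).tsum_sub S3]
    congr 1
    · rw [← H.step_zero]; ring
    · refine tsum_congr fun j => ?_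
      have := H.step_succ n j
      linear_combination (- φ (j + 1)) * this
  have e2 : (∑' j, p (n + 1) j * (s n / ρ j * φ (j + 1)))
      = (∑' j, p (n + 1) j * (s n / ρ j * φ j)) + s n * hitMean p (n + 1) ψ := by
    rw [hitMean, ← tsum_mul_left, ← S2.tsum_add ((H.summable (n + 1) hψ).mul_left _)]
    refine tsum_congr fun j => ?_
    have := (H.rho_pos j).ne'
    rw [h]
    field_simp
  rw [e1, e2, hitMean]
  ring

theorem mean_zero (H : IsHitLaw ρ s p) (φ : ℕ → ℝ) : hitMean p 0 φ = φ 0 := by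
  rw [hitMean, tsum_eq_single 0 fun j hj => by simp [H.init, hj]]
  simp [H.init]

theorem mean_const (H : IsHitLaw ρ s p) (n : ℕ) (c : ℝ) : hitMean p n (fun _ => c) = c := by
  induction n with
  | zero => exact H.mean_zero _
  | succ n ih =>
    rw [H.mean_step n (ψ := fun _ => 0) (by fun_prop) (by fun_prop) fun j => by ring, ih]
    simp [hitMean]

end IsHitLaw

/-- A nonnegative sequence with increments of order `n ^ (q - 1)`, up to a self-referential
term of relative order `n ^ (-2)`, is of order `n ^ q`. -/
theorem exists_le_rpow_of_increment_le {Q : ℕ → ℝ} {q C : ℝ} (hq : 1 ≤ q) (hQ : ∀ n, 0 ≤ Q n)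
    (h : ∀ᶠ n : ℕ in atTop, Q (n + 1) ≤ Q n +
      C * (((n + 1 : ℕ) : ℝ) ^ (q - 1) + Q (n + 1) / ((n + 1 : ℕ) : ℝ) ^ 2)) :
    ∃ K : ℝ, 0 < K ∧ ∀ᶠ n : ℕ in atTop, Q n ≤ K * (n : ℝ) ^ q := by
  obtain ⟨N₁, hN₁⟩ := eventually_atTop.1 h
  obtain ⟨N₂, hN₂⟩ := exists_nat_ge (2 * |C|)
  set N := max N₁ N₂ + 1 with hN
  refine ⟨Q N + 2 * |C| + 1, by linarith [hQ N, abs_nonneg C],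
    eventually_atTop.2 ⟨N, fun n hn => ?_⟩⟩
  have hC := le_abs_self C
  have hC0 := abs_nonneg C
  set K := Q N + 2 * |C| + 1 with hK
  induction n, hn using Nat.le_induction with
  | base =>
    have : (1 : ℝ) ≤ (N : ℝ) ^ q :=
      Real.one_le_rpow (by exact_mod_cast (by omega : 1 ≤ N))
        (by linarith)
    nlinarith [hQ N]
  | succ n hn ih =>
    have h1 := hN₁ n (le_trans (by omega) hn)
    set x : ℝ := ((n + 1 : ℕ) : ℝ) with hx
    have hxn : (n : ℝ) = x - 1 := by rw [hx]; push_cast; ring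
    have hn1 : (1 : ℝ) ≤ n := by
      have : 1 ≤ n := by omega
      exact_mod_cast this
    have hx2 : 2 * |C| ≤ x := by
      refine hN₂.trans ?_
      rw [hx]; exact_mod_cast (by omega)
    have hx0 : 0 < x := by linarith
    have e1 : x ^ q = x ^ (q - 1) * x := by
      rw [← Real.rpow_add_one hx0.ne']; ring_nf
    have e2 : (n : ℝ) ^ q ≤ x ^ (q - 1) * (x - 1) := by
      have : (n : ℝ) ^ q = (n : ℝ) ^ (q - 1) * n := by
        rw [← Real.rpow_add_one (by linarith)]; ring_nf
      rw [this, hxn]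
      gcongr
      · linarith
      · linarith
      · linarith
    have hP : 0 < x ^ (q - 1) := Real.rpow_pos_of_pos hx0 _
    have hQ1 := hQ (n + 1)
    have h2 : Q (n + 1) * (1 - |C| / x ^ 2) ≤ x ^ (q - 1) * (K * (x - 1) + |C|) := by
      have : Q n ≤ K * (x ^ (q - 1) * (x - 1)) := ih.trans (by gcongr; linarith [hQ N])
      have h3 : C * (x ^ (q - 1) + Q (n + 1) / x ^ 2)
          ≤ |C| * (x ^ (q - 1) + Q (n + 1) / x ^ 2) := by gcongr
      have : Q (n + 1) * (|C| / x ^ 2) = |C| * (Q (n + 1) / x ^ 2) := by ring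
      nlinarith
    have h4 : 0 < 1 - |C| / x ^ 2 := by
      rw [sub_pos, div_lt_one (by positivity)]
      nlinarith
    refine le_of_mul_le_mul_right (h2.trans ?_) h4
    rw [e1]
    have h5 : K * x * (1 - |C| / x ^ 2) = K * x - K * |C| / x := by field_simp
    have h6 : K * |C| / x ≤ K / 2 := by
      rw [div_le_div_iff₀ hx0 (by norm_num)]
      nlinarith [hQ N]
    have h7 : K * (x - 1) + |C| ≤ K * x * (1 - |C| / x ^ 2) := by
      rw [h5]; nlinarith [hQ N]
    calc _ ≤ x ^ (q - 1) * (K * x * (1 - |C| / x ^ 2)) := by gcongr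
      _ = _ := by ring

/-- Remainder estimate for one step of the centred fourth power. -/
theorem fourth_power_step_le {X M N s ρ C : ℝ} (hM : 0 ≤ M) (hN : 1 ≤ N) (hs : 0 ≤ s)
    (hρ : 0 ≤ ρ) (hC : 0 ≤ C) (hs' : s ≤ C * M) (hρ' : ρ ≤ C * (M + |X| / N)) :
    X ^ 4 ≤ (X + s) ^ 4 - s * (4 * (X + s) ^ 3 + 6 * (X + s) ^ 2 * ρ + 4 * (X + s) * ρ ^ 2 + ρ ^ 3)
      + (88 * C ^ 2 + 352 * C ^ 4) * (M ^ 2 * X ^ 2 + X ^ 4 / N ^ 2 + M ^ 4) := by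
  set y := |X| / N with hy
  have hy0 : 0 ≤ y := by positivity
  set a := C * (M + y) with ha
  have hsa : s ≤ a := hs'.trans (by rw [ha]; gcongr; linarith)
  have ha0 : 0 ≤ a := hs.trans hsa
  set Z := X + s with hZ
  set b := |X| + a with hb
  have hX0 := abs_nonneg X
  have hab : a ≤ b := by linarith
  have hZb : |Z| ≤ b := (abs_add_le _ _).trans (by rw [abs_of_nonneg hs]; linarith)
  have hZ0 := abs_nonneg Z
  have hZ2 : Z ^ 2 ≤ b ^ 2 := by rw [← sq_abs Z]; gcongr
  have t1 : s ^ 2 * Z ^ 2 ≤ s * a * b ^ 2 := by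
    rw [pow_two s]; gcongr
  have t2 : - (s ^ 3 * Z) ≤ s * a * b ^ 2 := by
    calc - (s ^ 3 * Z) ≤ s ^ 3 * |Z| := by nlinarith [neg_abs_le Z, pow_nonneg hs 3]
      _ = s * s * (s * |Z|) := by ring
      _ ≤ s * a * (b * b) := by gcongr; linarith
      _ = _ := by ring
  have t3 : s ^ 4 ≤ s * a * b ^ 2 := by
    calc s ^ 4 = s * s * (s * s) := by ring
      _ ≤ s * a * (b * b) := by gcongr <;> linarith
      _ = _ := by ring
  have t4 : s * (Z ^ 2 * ρ) ≤ s * a * b ^ 2 := by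
    calc s * (Z ^ 2 * ρ) ≤ s * (b ^ 2 * a) := by gcongr
      _ = _ := by ring
  have t5 : s * (Z * ρ ^ 2) ≤ s * a * b ^ 2 := by
    calc s * (Z * ρ ^ 2) ≤ s * (b * (a * b)) := by
          rw [pow_two ρ]
          gcongr
          · exact (le_abs_self Z).trans hZb
          · linarith
      _ = _ := by ring
  have t6 : s * ρ ^ 3 ≤ s * a * b ^ 2 := by
    calc s * ρ ^ 3 = s * (ρ * (ρ * ρ)) := by ring
      _ ≤ s * (a * (b * b)) := by gcongr <;> linarith
      _ = _ := by ring
  have hmain : X ^ 4 ≤ Z ^ 4 - s * (4 * Z ^ 3 + 6 * Z ^ 2 * ρ + 4 * Z * ρ ^ 2 + ρ ^ 3)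
      + 22 * (s * a * b ^ 2) := by
    have : X = Z - s := by rw [hZ]; ring
    rw [this]
    nlinarith
  suffices h : 22 * (s * a * b ^ 2) ≤ (88 * C ^ 2 + 352 * C ^ 4) *
      (M ^ 2 * X ^ 2 + X ^ 4 / N ^ 2 + M ^ 4) by linarith
  have hb2 : b ^ 2 ≤ 2 * (X ^ 2 + a ^ 2) := by
    rw [hb, ← sq_abs X]; nlinarith [sq_nonneg (|X| - a)]
  have hXy : |X| = y * N := by rw [hy]; field_simp
  have hX4 : X ^ 4 / N ^ 2 = X ^ 2 * y ^ 2 := by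
    rw [hy, div_pow, sq_abs]; ring
  have hyX : y ^ 2 ≤ X ^ 2 := by
    rw [← sq_abs X, hXy]
    have : y ≤ y * N := le_mul_of_one_le_right hy0 hN
    gcongr
  have m1 : M ^ 2 + M * y ≤ 2 * (M ^ 2 + y ^ 2) := by
    nlinarith [sq_nonneg (M - y), sq_nonneg (M + y)]
  have u1 : s * a * X ^ 2 ≤ 2 * C ^ 2 * (M ^ 2 * X ^ 2 + X ^ 2 * y ^ 2) := by
    calc s * a * X ^ 2 ≤ (C * M) * a * X ^ 2 := by gcongr
      _ = C ^ 2 * X ^ 2 * (M ^ 2 + M * y) := by rw [ha]; ring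
      _ ≤ C ^ 2 * X ^ 2 * (2 * (M ^ 2 + y ^ 2)) := mul_le_mul_of_nonneg_left m1 (by positivity)
      _ = _ := by ring
  have m2 : (M + y) ^ 4 ≤ 8 * (M ^ 4 + X ^ 2 * y ^ 2) := by
    have k1 := add_pow_le hM hy0 4
    have k2 : y ^ 4 ≤ X ^ 2 * y ^ 2 := by
      calc y ^ 4 = y ^ 2 * y ^ 2 := by ring
        _ ≤ _ := mul_le_mul_of_nonneg_right hyX (sq_nonneg y)
    norm_num at k1
    linarith
  have u2 : s * a * a ^ 2 ≤ 8 * C ^ 4 * (M ^ 4 + X ^ 2 * y ^ 2) := by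
    calc s * a * a ^ 2 ≤ a * a * a ^ 2 := by gcongr
      _ = C ^ 4 * (M + y) ^ 4 := by rw [ha]; ring
      _ ≤ C ^ 4 * (8 * (M ^ 4 + X ^ 2 * y ^ 2)) := mul_le_mul_of_nonneg_left m2 (by positivity)
      _ = _ := by ring
  rw [hX4]
  have w1 : 0 ≤ C ^ 2 * M ^ 4 := by positivity
  have w2 : 0 ≤ C ^ 4 * (M ^ 2 * X ^ 2) := by positivity
  have w4 : s * a * b ^ 2 ≤ s * a * (2 * (X ^ 2 + a ^ 2)) :=
    mul_le_mul_of_nonneg_left hb2 (mul_nonneg hs ha0)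
  linarith

namespace IsHitLaw

variable {ρ s : ℕ → ℝ} {p : ℕ → ℕ → ℝ}

theorem mean_sum_rho (H : IsHitLaw ρ s p) (hρ : PolyGrowth ρ) (n : ℕ) :
    hitMean p n (fun j => ∑ k ∈ Finset.range j, ρ k) = ∑ k ∈ Finset.range n, s k := by
  induction n with
  | zero => simp [H.mean_zero]
  | succ n ih =>
    rw [H.mean_step n (ψ := fun _ => 1) hρ.sum_range (by fun_prop)
      fun j => by rw [Finset.sum_range_succ]; ring, ih, H.mean_const, Finset.sum_range_succ,
      mul_one]

theorem mean_sq_sum_rho (H : IsHitLaw ρ s p) (hρ : PolyGrowth ρ) (n : ℕ) :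
    hitMean p n (fun j => (∑ k ∈ Finset.range j, ρ k - ∑ k ∈ Finset.range n, s k) ^ 2)
      = ∑ k ∈ Finset.range n, s k ^ 2 +
        hitMean p n (fun j => ∑ k ∈ Finset.range j, ρ k ^ 2) := by
  have hf := hρ.sum_range
  have hv := (hρ.pow 2).sum_range
  have key : hitMean p n (fun j => (∑ k ∈ Finset.range j, ρ k) ^ 2
      - ∑ k ∈ Finset.range j, ρ k ^ 2)
      = (∑ k ∈ Finset.range n, s k) ^ 2 + ∑ k ∈ Finset.range n, s k ^ 2 := by
    induction n with
    | zero => simp [H.mean_zero]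
    | succ n ih =>
      rw [H.mean_step n (ψ := fun j => 2 * ∑ k ∈ Finset.range j, ρ k) (by fun_prop) (by fun_prop)
        fun j => by simp only [Finset.sum_range_succ]; ring, ih, mean_const_mul,
        H.mean_sum_rho hρ]
      simp only [Finset.sum_range_succ]
      ring
  have e : (fun j => (∑ k ∈ Finset.range j, ρ k - ∑ k ∈ Finset.range n, s k) ^ 2)
      = fun j => (((∑ k ∈ Finset.range j, ρ k) ^ 2 - ∑ k ∈ Finset.range j, ρ k ^ 2)
        + ∑ k ∈ Finset.range j, ρ k ^ 2)
        + ((-2 * ∑ k ∈ Finset.range n, s k) * (∑ k ∈ Finset.range j, ρ k)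
          + (∑ k ∈ Finset.range n, s k) ^ 2) := by
    funext j; ring
  rw [e, H.mean_add _ (by fun_prop) (by fun_prop), H.mean_add _ (by fun_prop) (by fun_prop),
    H.mean_add _ (by fun_prop) (by fun_prop), mean_const_mul, H.mean_sum_rho hρ, H.mean_const, key]
  ring

end IsHitLaw

theorem exists_le_mul_of_tendsto_div {a b : ℕ → ℝ} {l : ℝ}
    (h : Tendsto (fun n => a n / b n) atTop (nhds l))
    (hb : ∀ n, 0 ≤ b n) (hab : ∀ n, b n = 0 → a n = 0) :
    ∃ C : ℝ, 0 < C ∧ ∀ n, a n ≤ C * b n := by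
  obtain ⟨C, hC⟩ := h.bddAbove_range
  refine ⟨|C| + 1, by positivity, fun n => ?_⟩
  rcases (hb n).eq_or_lt with h0 | h0
  · simp [hab n h0.symm, ← h0]
  · have h1 : a n / b n ≤ C := hC ⟨n, rfl⟩
    rw [div_le_iff₀ h0] at h1
    refine h1.trans ?_
    gcongr
    linarith [le_abs_self C]

/-- Positive sequences `x` of order `n ^ α` whose partial sums `F` satisfy
`(F n / A) ^ (1 / (α + 1)) = n + c + o(1)`. -/
structure RegularRates (α A K c : ℝ) (x : ℕ → ℝ) : Prop where
  pos : ∀ n, 0 < x n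
  bound : ∃ C : ℝ, 0 < C ∧ ∀ n, x n ≤ C * ((n : ℝ) + 1) ^ α
  sum : Tendsto (fun n : ℕ => (∑ k ∈ Finset.range n, x k) / (n : ℝ) ^ (α + 1)) atTop (nhds A)
  sq_sum : Tendsto (fun n : ℕ => (∑ k ∈ Finset.range n, x k ^ 2) / (n : ℝ) ^ (2 * α + 1))
    atTop (nhds K)
  root : Tendsto (fun n : ℕ => ((∑ k ∈ Finset.range n, x k) / A) ^ (1 / (α + 1)) - (n : ℝ))
    atTop (nhds c)

namespace RegularRates

variable {α A K c : ℝ} {x : ℕ → ℝ}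

theorem sum_nonneg (R : RegularRates α A K c x) (n : ℕ) : 0 ≤ ∑ k ∈ Finset.range n, x k :=
  Finset.sum_nonneg fun k _ => (R.pos k).le

theorem sum_pos (R : RegularRates α A K c x) {n : ℕ} (hn : n ≠ 0) :
    0 < ∑ k ∈ Finset.range n, x k :=
  Finset.sum_pos (fun k _ => R.pos k) (by simpa using hn)

theorem polyGrowth (R : RegularRates α A K c x) (hα : 0 < α) : PolyGrowth x := by
  obtain ⟨C, -, hC⟩ := R.bound
  refine PolyGrowth.of_abs_le (ψ := fun j => C * ((j : ℝ) + 1) ^ α) ?_ fun j => ?_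
  · exact (PolyGrowth.const C).mul
      (PolyGrowth.rpow (φ := fun j => (j : ℝ) + 1) (by fun_prop) (fun j => by positivity) hα.le)
  · rw [abs_of_pos (R.pos j)]; exact hC j

theorem sum_le (R : RegularRates α A K c x) (hα : 0 < α) :
    ∃ C : ℝ, 0 < C ∧ ∀ n : ℕ, ∑ k ∈ Finset.range n, x k ≤ C * (n : ℝ) ^ (α + 1) := by
  refine exists_le_mul_of_tendsto_div R.sum (fun n => by positivity) fun n hn => ?_
  rw [Real.rpow_eq_zero (by positivity) (by linarith)] at hn
  have : n = 0 := by exact_mod_cast hn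
  simp [this]

theorem rpow_le_sum (R : RegularRates α A K c x) (hα : 0 < α) (hA : 0 < A) :
    ∃ C : ℝ, 0 < C ∧ ∀ n : ℕ, (n : ℝ) ^ (α + 1) ≤ C * ∑ k ∈ Finset.range n, x k := by
  refine exists_le_mul_of_tendsto_div (l := A⁻¹) ?_ R.sum_nonneg fun n hn => ?_
  · simpa using R.sum.inv₀ hA.ne'
  · by_contra h0
    have : n ≠ 0 := by
      rintro rfl
      exact h0 (by simp [Real.zero_rpow (by linarith : α + 1 ≠ 0)])
    exact (R.sum_pos this).ne' hn

theorem sq_sum_le (R : RegularRates α A K c x) (hα : 0 < α) :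
    ∃ C : ℝ, 0 < C ∧ ∀ n : ℕ, ∑ k ∈ Finset.range n, x k ^ 2 ≤ C * (n : ℝ) ^ (2 * α + 1) := by
  refine exists_le_mul_of_tendsto_div R.sq_sum (fun n => by positivity) fun n hn => ?_
  rw [Real.rpow_eq_zero (by positivity) (by linarith)] at hn
  have : n = 0 := by exact_mod_cast hn
  simp [this]

theorem le_rpow_add_sum_div (R : RegularRates α A K c x) (hα : 0 < α) (hA : 0 < A) :
    ∃ C : ℝ, 0 < C ∧ ∀ N j : ℕ, N ≠ 0 →
      x j ≤ C * ((N : ℝ) ^ α + (∑ k ∈ Finset.range j, x k) / N) := by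
  obtain ⟨C, hC0, hC⟩ := R.bound
  obtain ⟨D, hD0, hD⟩ := R.rpow_le_sum hα hA
  refine ⟨C * 2 ^ α * (1 + D), by positivity, fun N j hN => (hC j).trans ?_⟩
  have hN0 : (0 : ℝ) < N := by positivity
  have hf := R.sum_nonneg j
  rw [mul_assoc, mul_assoc]
  gcongr
  have hfN : 0 ≤ (∑ k ∈ Finset.range j, x k) / N := by positivity
  have hNα : 0 ≤ (N : ℝ) ^ α := by positivity
  rcases le_or_gt j N with h | h
  · have h1 : ((j : ℝ) + 1) ^ α ≤ (2 * (N : ℝ)) ^ α := by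
      gcongr
      have h2 : (j : ℝ) ≤ N := by exact_mod_cast h
      have h3 : (1 : ℝ) ≤ N := by exact_mod_cast Nat.one_le_iff_ne_zero.2 hN
      linarith
    rw [Real.mul_rpow (by norm_num) hN0.le] at h1
    refine h1.trans ?_
    gcongr
    nlinarith
  · have h2 : (N : ℝ) < j := by exact_mod_cast h
    have hj0 : (0 : ℝ) < j := hN0.trans h2
    have h1 : ((j : ℝ) + 1) ^ α ≤ (2 * (j : ℝ)) ^ α := by
      gcongr
      have h3 : (1 : ℝ) ≤ j := by exact_mod_cast (by omega : 1 ≤ j)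
      linarith
    rw [Real.mul_rpow (by norm_num) hj0.le] at h1
    refine h1.trans ?_
    gcongr
    have h3 : (j : ℝ) ^ α ≤ D * ((∑ k ∈ Finset.range j, x k) / N) := by
      have := hD j
      rw [Real.rpow_add_one hj0.ne'] at this
      rw [← mul_div_assoc, le_div_iff₀ hN0]
      refine le_trans ?_ this
      gcongr
    nlinarith

theorem sq_sum_le_add (R : RegularRates α A K c x) (hα : 0 < α) (hA : 0 < A) :
    ∃ C : ℝ, 0 < C ∧ ∀ N j : ℕ, N ≠ 0 → ∑ k ∈ Finset.range j, x k ^ 2 ≤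
      C * ((N : ℝ) ^ (2 * α + 1) + (∑ k ∈ Finset.range j, x k) ^ 2 / N) := by
  obtain ⟨C, hC0, hC⟩ := R.sq_sum_le hα
  obtain ⟨D, hD0, hD⟩ := R.rpow_le_sum hα hA
  refine ⟨C * (1 + D ^ 2), by positivity, fun N j hN => (hC j).trans ?_⟩
  have hN0 : (0 : ℝ) < N := by positivity
  have hf := R.sum_nonneg j
  rw [mul_assoc]
  gcongr
  have hfN : 0 ≤ (∑ k ∈ Finset.range j, x k) ^ 2 / N := by positivity
  have hNα : 0 ≤ (N : ℝ) ^ (2 * α + 1) := by positivity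
  have hD2 := sq_nonneg D
  rcases le_or_gt j N with h | h
  · have h1 : (j : ℝ) ^ (2 * α + 1) ≤ (N : ℝ) ^ (2 * α + 1) := by
      gcongr
    nlinarith
  · have h2 : (N : ℝ) < j := by exact_mod_cast h
    have hj0 : (0 : ℝ) < j := hN0.trans h2
    have h3 : (j : ℝ) ^ (2 * α + 1) ≤ D ^ 2 * ((∑ k ∈ Finset.range j, x k) ^ 2 / N) := by
      have h4 := hD j
      have h5 : (j : ℝ) ^ (2 * α + 1) * j = ((j : ℝ) ^ (α + 1)) ^ 2 := by
        rw [← Real.rpow_add_one hj0.ne', ← Real.rpow_mul_natCast hj0.le]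
        congr 1; push_cast; ring
      rw [← mul_div_assoc, le_div_iff₀ hN0, ← mul_pow]
      calc (j : ℝ) ^ (2 * α + 1) * N ≤ (j : ℝ) ^ (2 * α + 1) * j := by gcongr
        _ = ((j : ℝ) ^ (α + 1)) ^ 2 := h5
        _ ≤ _ := by gcongr
    nlinarith

end RegularRates

namespace IsHitLaw

variable {ρ s : ℕ → ℝ} {p : ℕ → ℕ → ℝ} {α A K cρ cs : ℝ}

theorem second_moment_le (H : IsHitLaw ρ s p) (hα : 0 < α) (hA : 0 < A)
    (Rρ : RegularRates α A K cρ ρ) (Rs : RegularRates α A K cs s) :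
    ∃ C : ℝ, 0 < C ∧ ∀ᶠ n : ℕ in atTop,
      hitMean p n (fun j => (∑ k ∈ Finset.range j, ρ k - ∑ k ∈ Finset.range n, s k) ^ 2)
        ≤ C * (n : ℝ) ^ (2 * α + 1) := by
  obtain ⟨C₁, hC₁, h₁⟩ := Rρ.sq_sum_le_add hα hA
  obtain ⟨C₂, hC₂, h₂⟩ := Rs.sq_sum_le hα
  obtain ⟨C₃, hC₃, h₃⟩ := Rs.sum_le hα
  have hρ := Rρ.polyGrowth hα
  have hf := hρ.sum_range
  obtain ⟨M, hM⟩ := exists_nat_ge (4 * C₁)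
  refine ⟨2 * (C₂ + C₁ + 2 * C₁ * C₃ ^ 2), by positivity,
    eventually_atTop.2 ⟨M + 1, fun n hn => ?_⟩⟩
  have hn0 : n ≠ 0 := by omega
  have hnp : (0 : ℝ) < n := by positivity
  have hnM : 4 * C₁ ≤ n := hM.trans (by exact_mod_cast (by omega))
  set g := ∑ k ∈ Finset.range n, s k with hg
  have hg0 : 0 ≤ g := Rs.sum_nonneg n
  set m := hitMean p n (fun j => (∑ k ∈ Finset.range j, ρ k - g) ^ 2) with hm
  have hm0 : 0 ≤ m := H.mean_nonneg n fun j => sq_nonneg _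
  have e := H.mean_sq_sum_rho hρ n
  rw [← hg, ← hm] at e
  have hb : hitMean p n (fun j => ∑ k ∈ Finset.range j, ρ k ^ 2)
      ≤ C₁ * (n : ℝ) ^ (2 * α + 1) + C₁ / n * (2 * g ^ 2) + (C₁ / n * 2) * m := by
    have := H.mean_mono n (φ := fun j => ∑ k ∈ Finset.range j, ρ k ^ 2)
      (ψ := fun j => (C₁ * (n : ℝ) ^ (2 * α + 1) + C₁ / n * (2 * g ^ 2))
        + (C₁ / n * 2) * (∑ k ∈ Finset.range j, ρ k - g) ^ 2)
      (hρ.pow 2).sum_range (by fun_prop) fun j => ?_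
    · rwa [H.mean_add _ (by fun_prop) (by fun_prop), H.mean_const, mean_const_mul] at this
    · refine (h₁ n j hn0).trans ?_
      set f := ∑ k ∈ Finset.range j, ρ k
      have : f ^ 2 ≤ 2 * g ^ 2 + 2 * (f - g) ^ 2 := by nlinarith [sq_nonneg (f - 2 * g)]
      calc C₁ * ((n : ℝ) ^ (2 * α + 1) + f ^ 2 / n)
          ≤ C₁ * ((n : ℝ) ^ (2 * α + 1) + (2 * g ^ 2 + 2 * (f - g) ^ 2) / n) := by gcongr
        _ = _ := by ring
  have h4 : C₁ / n * 2 ≤ 1 / 2 := by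
    rw [div_mul_eq_mul_div, div_le_div_iff₀ hnp (by norm_num)]; linarith
  have h5 : C₁ / n * (2 * g ^ 2) ≤ 2 * C₁ * C₃ ^ 2 * (n : ℝ) ^ (2 * α + 1) := by
    have h6 : (n : ℝ) ^ (2 * α + 1) * n = ((n : ℝ) ^ (α + 1)) ^ 2 := by
      rw [← Real.rpow_add_one hnp.ne', ← Real.rpow_mul_natCast hnp.le]
      congr 1; push_cast; ring
    have h7 : g ^ 2 ≤ C₃ ^ 2 * ((n : ℝ) ^ (2 * α + 1) * n) := by
      rw [h6, ← mul_pow]; gcongr; exact h₃ n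
    rw [div_mul_eq_mul_div, div_le_iff₀ hnp]
    nlinarith
  have h8 := h₂ n
  nlinarith

theorem fourth_moment_le (H : IsHitLaw ρ s p) (hα : 0 < α) (hA : 0 < A)
    (Rρ : RegularRates α A K cρ ρ) (Rs : RegularRates α A K cs s) :
    ∃ C : ℝ, 0 < C ∧ ∀ᶠ n : ℕ in atTop,
      hitMean p n (fun j => (∑ k ∈ Finset.range j, ρ k - ∑ k ∈ Finset.range n, s k) ^ 4)
        ≤ C * (n : ℝ) ^ (4 * α + 2) := by
  obtain ⟨C₁, hC₁, h₁⟩ := Rρ.le_rpow_add_sum_div hα hA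
  obtain ⟨C₂, hC₂, h₂⟩ := Rs.bound
  obtain ⟨C₃, hC₃, h₃⟩ := Rs.sum_le hα
  obtain ⟨C₄, hC₄, h₄⟩ := H.second_moment_le hα hA Rρ Rs
  have hρ := Rρ.polyGrowth hα
  have hf := hρ.sum_range
  set C := C₂ + C₁ * (1 + C₃) with hC
  have hC0 : 0 < C := by positivity
  set D := 88 * C ^ 2 + 352 * C ^ 4 with hD
  have hD0 : 0 < D := by positivity
  refine exists_le_rpow_of_increment_le (C := D * (C₄ + 1)) (by linarith)
    (fun n => H.mean_nonneg n fun j => by positivity) ?_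
  filter_upwards [(tendsto_add_atTop_nat 1).eventually h₄] with n hn
  set N : ℝ := ((n + 1 : ℕ) : ℝ) with hN
  have hN1 : 1 ≤ N := by rw [hN]; push_cast; linarith [(Nat.cast_nonneg n : (0 : ℝ) ≤ n)]
  have hN0 : 0 < N := by linarith
  set g := ∑ k ∈ Finset.range n, s k with hg
  set g' := ∑ k ∈ Finset.range (n + 1), s k with hg'
  have hgg : g' = g + s n := Finset.sum_range_succ _ _
  set m := hitMean p (n + 1) (fun j => (∑ k ∈ Finset.range j, ρ k - g') ^ 2) with hm
  set Q := hitMean p (n + 1) (fun j => (∑ k ∈ Finset.range j, ρ k - g') ^ 4) with hQ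
  have hQ0 : 0 ≤ Q := H.mean_nonneg _ fun j => by positivity
  have step := H.mean_step n (φ := fun j => (∑ k ∈ Finset.range j, ρ k - g) ^ 4)
    (ψ := fun j => 4 * (∑ k ∈ Finset.range j, ρ k - g) ^ 3
      + 6 * (∑ k ∈ Finset.range j, ρ k - g) ^ 2 * ρ j
      + 4 * (∑ k ∈ Finset.range j, ρ k - g) * ρ j ^ 2 + ρ j ^ 3)
    (by fun_prop) (by fun_prop) fun j => by rw [Finset.sum_range_succ]; ring
  have hle : Q ≤ hitMean p n (fun j => (∑ k ∈ Finset.range j, ρ k - g) ^ 4)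
      + (D * (N ^ α) ^ 2 * m + D / N ^ 2 * Q + D * (N ^ α) ^ 4) := by
    have := H.mean_mono (n + 1) (φ := fun j => (∑ k ∈ Finset.range j, ρ k - g') ^ 4)
      (ψ := fun j => ((∑ k ∈ Finset.range j, ρ k - g) ^ 4
        - s n * (4 * (∑ k ∈ Finset.range j, ρ k - g) ^ 3
      + 6 * (∑ k ∈ Finset.range j, ρ k - g) ^ 2 * ρ j
      + 4 * (∑ k ∈ Finset.range j, ρ k - g) * ρ j ^ 2 + ρ j ^ 3))
      + (D * (N ^ α) ^ 2 * (∑ k ∈ Finset.range j, ρ k - g') ^ 2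
        + D / N ^ 2 * (∑ k ∈ Finset.range j, ρ k - g') ^ 4 + D * (N ^ α) ^ 4))
      (by fun_prop) (by fun_prop) fun j => ?_
    · rw [H.mean_add _ (by fun_prop) (by fun_prop), H.mean_sub _ (by fun_prop) (by fun_prop),
        H.mean_add _ (by fun_prop) (by fun_prop), H.mean_add _ (by fun_prop) (by fun_prop),
        mean_const_mul, mean_const_mul, mean_const_mul, H.mean_const, ← hm, ← hQ, step] at this
      linarith
    · set f := ∑ k ∈ Finset.range j, ρ k
      have hZ : f - g = (f - g') + s n := by rw [hgg]; ring
      have hs' : s n ≤ C * N ^ α := by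
        refine (h₂ n).trans ?_
        rw [hN]; push_cast
        gcongr
        rw [hC]; nlinarith
      have hρ' : ρ j ≤ C * (N ^ α + |f - g'| / N) := by
        have k1 : f / N ≤ |f - g'| / N + C₃ * N ^ α := by
          have k2 := h₃ (n + 1)
          rw [← hN, Real.rpow_add_one hN0.ne', ← hg'] at k2
          rw [div_add' _ _ _ hN0.ne']
          gcongr
          linarith [le_abs_self (f - g')]
        have k3 : 0 ≤ |f - g'| / N := by positivity
        have k4 : 0 ≤ N ^ α := by positivity
        calc ρ j ≤ C₁ * (N ^ α + f / N) := h₁ (n + 1) j (by omega)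
          _ ≤ C₁ * (N ^ α + (|f - g'| / N + C₃ * N ^ α)) := by gcongr
          _ ≤ C₁ * ((1 + C₃) * (N ^ α + |f - g'| / N)) := by gcongr; nlinarith
          _ = C₁ * (1 + C₃) * (N ^ α + |f - g'| / N) := by ring
          _ ≤ C * (N ^ α + |f - g'| / N) := by gcongr; rw [hC]; linarith
      have := fourth_power_step_le (X := f - g') (M := N ^ α) (by positivity) hN1
        (Rs.pos n).le (Rρ.pos j).le hC0.le hs' hρ'
      rw [← hZ, ← hD] at this
      refine this.trans (le_of_eq ?_)
      ring
  refine hle.trans ?_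
  have e1 : N ^ (4 * α + 2 - 1) = (N ^ α) ^ 4 * N := by
    rw [← Real.rpow_mul_natCast hN0.le, ← Real.rpow_add_one hN0.ne']
    congr 1; push_cast; ring
  have e2 : (N ^ α) ^ 2 * N ^ (2 * α + 1) = (N ^ α) ^ 4 * N := by
    rw [← Real.rpow_mul_natCast hN0.le, ← Real.rpow_mul_natCast hN0.le,
      ← Real.rpow_add_one hN0.ne', ← Real.rpow_add hN0]
    congr 1; push_cast; ring
  rw [e1]
  have hP : 0 ≤ (N ^ α) ^ 4 := by positivity
  have i1 : D * (N ^ α) ^ 2 * m ≤ D * C₄ * ((N ^ α) ^ 4 * N) := by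
    calc D * (N ^ α) ^ 2 * m ≤ D * (N ^ α) ^ 2 * (C₄ * N ^ (2 * α + 1)) := by gcongr
      _ = D * C₄ * ((N ^ α) ^ 2 * N ^ (2 * α + 1)) := by ring
      _ = _ := by rw [e2]
  have i2 : D * (N ^ α) ^ 4 ≤ D * ((N ^ α) ^ 4 * N) := by
    gcongr; exact le_mul_of_one_le_right hP hN1
  have i3 : D / N ^ 2 * Q ≤ D * (C₄ + 1) * (Q / N ^ 2) := by
    have : 0 ≤ D * C₄ * (Q / N ^ 2) := by positivity
    have e3 : D / N ^ 2 * Q = D * (Q / N ^ 2) := by ring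
    linarith
  linarith

end IsHitLaw

theorem tendsto_rpow_second_order (q : ℝ) :
    Tendsto (fun x : ℝ => ((1 + x) ^ q - 1 - q * x) / x ^ 2) (nhdsWithin 0 {0}ᶜ)
      (nhds (q * (q - 1) / 2)) := by
  have hpos : ∀ᶠ x : ℝ in nhdsWithin 0 {0}ᶜ, 0 < 1 + x := by
    refine nhdsWithin_le_nhds ?_
    have : Tendsto (fun x : ℝ => 1 + x) (nhds 0) (nhds (1 + 0)) :=
      tendsto_const_nhds.add tendsto_id
    exact this.eventually (lt_mem_nhds (by norm_num))
  have hder : ∀ (r : ℝ) {x : ℝ}, 0 < 1 + x →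
      HasDerivAt (fun x : ℝ => (1 + x) ^ r) (r * (1 + x) ^ (r - 1)) x := by
    intro r x hx
    simpa using ((hasDerivAt_id x).const_add 1).rpow_const (p := r) (Or.inl hx.ne')
  refine HasDerivAt.lhopital_zero_nhdsNE
    (f' := fun x => q * (1 + x) ^ (q - 1) - q) (g' := fun x => 2 * x) ?_ ?_ ?_ ?_ ?_ ?_
  · filter_upwards [hpos] with x hx
    exact (((hder q hx).sub_const 1).sub ((hasDerivAt_id x).const_mul q)).congr_deriv (by ring)
  · filter_upwards with x
    simpa using hasDerivAt_pow 2 x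
  · filter_upwards [self_mem_nhdsWithin] with x hx
    simpa using hx
  · have h0 : ContinuousAt (fun x : ℝ => (1 + x) ^ q - 1 - q * x) 0 :=
      (((hder q (x := 0) (by norm_num)).sub_const 1).sub
        ((hasDerivAt_id (0 : ℝ)).const_mul q)).continuousAt
    have := h0.tendsto
    simp only [add_zero, Real.one_rpow, mul_zero, sub_self] at this
    exact this.mono_left nhdsWithin_le_nhds
  · have : Tendsto (fun x : ℝ => x ^ 2) (nhds 0) (nhds (0 ^ 2)) := (continuous_pow 2).tendsto 0
    simp only [ne_eq, OfNat.ofNat_ne_zero, not_false_eq_true, zero_pow] at this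
    exact this.mono_left nhdsWithin_le_nhds
  · have h := ((hder (q - 1) (x := 0) (by norm_num)).const_mul (q / 2)).tendsto_slope_zero
    simp only [zero_add, add_zero, Real.one_rpow, smul_eq_mul, mul_one] at h
    have e : q / 2 * (q - 1) = q * (q - 1) / 2 := by ring
    rw [e] at h
    refine h.congr' ?_
    filter_upwards [self_mem_nhdsWithin] with x hx
    have : x ≠ 0 := by simpa using hx
    field_simp

theorem abs_rpow_sub_one_le {x a b : ℝ} (hx : 0 ≤ x) (ha : 0 < a) (hab : a ≤ b) :
    |x ^ a - 1| ≤ |x ^ b - 1| := by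
  rcases le_total x 1 with h | h
  · have h1 := Real.rpow_le_one hx h ha.le
    have h2 := Real.rpow_le_one hx h (ha.le.trans hab)
    have h3 : x ^ b ≤ x ^ a := by
      rcases hx.eq_or_lt with h0 | h0
      · rw [← h0, Real.zero_rpow ha.ne', Real.zero_rpow (ha.trans_le hab).ne']
      · exact Real.rpow_le_rpow_of_exponent_ge h0 h hab
    rw [abs_of_nonpos (by linarith), abs_of_nonpos (by linarith)]
    linarith
  · have h1 := Real.one_le_rpow h ha.le
    have h2 := Real.rpow_le_rpow_of_exponent_le h hab
    rw [abs_of_nonneg (by linarith), abs_of_nonneg (by linarith)]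
    linarith

theorem exists_rpow_taylor_le {q : ℝ} (hq0 : 0 < q) (hq1 : q < 1) {ε : ℝ} (hε : 0 < ε) :
    ∃ C : ℝ, 0 < C ∧ ∀ x : ℝ, 0 ≤ x →
      |x ^ q - (1 + q * (x - 1) + q * (q - 1) / 2 * (x - 1) ^ 2)|
        ≤ ε * (x - 1) ^ 2 + C * (x - 1) ^ 4 := by
  have h := (Metric.tendsto_nhdsWithin_nhds.1 (tendsto_rpow_second_order q)) ε hε
  obtain ⟨δ, hδ, h⟩ := h
  refine ⟨2 / δ ^ 3 + 1 / δ ^ 2, by positivity, fun x hx => ?_⟩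
  set y := x - 1 with hy
  have hxy : x = 1 + y := by rw [hy]; ring
  have hC : 0 ≤ (2 / δ ^ 3 + 1 / δ ^ 2) * y ^ 4 := by positivity
  rcases eq_or_ne y 0 with h0 | h0
  · simp [hxy, h0]
  rcases lt_or_ge |y| δ with h1 | h1
  · have h2 := h (x := y) (by simpa using h0) (by simpa [Real.dist_eq] using h1)
    rw [Real.dist_eq] at h2
    have hy2 : 0 < y ^ 2 := by positivity
    have e : (1 + y) ^ q - (1 + q * y + q * (q - 1) / 2 * y ^ 2)
        = (((1 + y) ^ q - 1 - q * y) / y ^ 2 - q * (q - 1) / 2) * y ^ 2 := by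
      field_simp
      ring
    rw [hxy, e, abs_mul, abs_of_pos hy2]
    nlinarith
  · have h2 : |x ^ q - 1| ≤ |y| := by
      simpa using abs_rpow_sub_one_le hx hq0 hq1.le
    have h3 : |x ^ q - (1 + q * y + q * (q - 1) / 2 * y ^ 2)| ≤ 2 * |y| + y ^ 2 := by
      have k1 : |q * y| ≤ |y| := by
        rw [abs_mul, abs_of_pos hq0]; exact mul_le_of_le_one_left (abs_nonneg _) hq1.le
      have k2 : |q * (q - 1) / 2 * y ^ 2| ≤ y ^ 2 := by
        rw [abs_mul, abs_of_nonneg (sq_nonneg y)]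
        refine mul_le_of_le_one_left (sq_nonneg y) ?_
        rw [abs_le]; constructor <;> nlinarith
      calc _ = |(x ^ q - 1) - q * y - q * (q - 1) / 2 * y ^ 2| := by congr 1; ring
        _ ≤ |x ^ q - 1| + |q * y| + |q * (q - 1) / 2 * y ^ 2| :=
          (abs_sub _ _).trans (by gcongr; exact abs_sub _ _)
        _ ≤ _ := by linarith
    have h4 : 2 * |y| ≤ 2 / δ ^ 3 * y ^ 4 := by
      have : 2 / δ ^ 3 * y ^ 4 = 2 * |y| * (|y| ^ 3 / δ ^ 3) := by
        have : y ^ 4 = |y| ^ 4 := by rw [← abs_pow]; exact (abs_of_nonneg (by positivity)).symm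
        rw [this]; ring
      rw [this]
      refine le_mul_of_one_le_right (by positivity) ?_
      rw [one_le_div (by positivity)]
      gcongr
    have h5 : y ^ 2 ≤ 1 / δ ^ 2 * y ^ 4 := by
      have : 1 / δ ^ 2 * y ^ 4 = y ^ 2 * (|y| ^ 2 / δ ^ 2) := by rw [sq_abs]; ring
      rw [this]
      refine le_mul_of_one_le_right (by positivity) ?_
      rw [one_le_div (by positivity)]
      gcongr
    have h6 : 0 ≤ ε * y ^ 2 := by positivity
    nlinarith

namespace IsHitLaw

variable {ρ s : ℕ → ℝ} {p : ℕ → ℕ → ℝ}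

theorem tendsto_mean_zero (H : IsHitLaw ρ s p) {φ D : ℕ → ℕ → ℝ}
    (hD : ∀ n, PolyGrowth (D n)) (hD0 : Tendsto (fun n => hitMean p n (D n)) atTop (nhds 0))
    (h : ∀ ε > 0, ∃ C : ℝ, ∀ᶠ n in atTop, ∀ j, |φ n j| ≤ ε + C * D n j) :
    Tendsto (fun n => hitMean p n (φ n)) atTop (nhds 0) := by
  rw [Metric.tendsto_nhds]
  intro ε hε
  obtain ⟨C, hC⟩ := h (ε / 2) (by positivity)
  have h1 : Tendsto (fun n => ε / 2 + C * hitMean p n (D n)) atTop (nhds (ε / 2 + C * 0)) :=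
    tendsto_const_nhds.add (hD0.const_mul C)
  filter_upwards [hC, h1.eventually (gt_mem_nhds (by linarith : ε / 2 + C * 0 < ε))] with n hn hn1
  have hDn := hD n
  have := H.abs_mean_le n (ψ := fun j => ε / 2 + C * D n j) (by fun_prop) hn
  rw [H.mean_add _ (by fun_prop) (by fun_prop), H.mean_const, mean_const_mul] at this
  simpa [Real.dist_eq] using this.trans_lt hn1

end IsHitLaw

theorem exists_abs_le_mul_add_of_tendsto_div {a b : ℕ → ℝ} {l : ℝ}
    (h : Tendsto (fun n => a n / b n) atTop (nhds l)) (hb : ∀ᶠ n in atTop, 0 < b n)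
    (hb0 : ∀ n, 0 ≤ b n) {ε : ℝ} (hε : 0 < ε) :
    ∃ C : ℝ, ∀ n, |a n - l * b n| ≤ ε * b n + C := by
  obtain ⟨N, hN⟩ := eventually_atTop.1 (hb.and (Metric.tendsto_nhds.1 h ε hε))
  refine ⟨∑ k ∈ Finset.range N, |a k - l * b k|, fun n => ?_⟩
  have h0 : 0 ≤ ε * b n := mul_nonneg hε.le (hb0 n)
  rcases lt_or_ge n N with hn | hn
  · have := Finset.single_le_sum (f := fun k => |a k - l * b k|) (fun k _ => abs_nonneg _)
      (Finset.mem_range.2 hn)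
    linarith
  · obtain ⟨hbn, hd⟩ := hN n hn
    have hs : 0 ≤ ∑ k ∈ Finset.range N, |a k - l * b k| := Finset.sum_nonneg fun k _ => abs_nonneg _
    rw [Real.dist_eq] at hd
    have e : a n - l * b n = (a n / b n - l) * b n := by field_simp
    rw [e, abs_mul, abs_of_pos hbn]
    nlinarith

/-- The partial sum of `ρ` up to `j`, relative to the partial sum of `s` up to `n`. -/
noncomputable def sumRatio (ρ s : ℕ → ℝ) (n j : ℕ) : ℝ :=
  (∑ k ∈ Finset.range j, ρ k) / ∑ k ∈ Finset.range n, s k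

namespace IsHitLaw

variable {ρ s : ℕ → ℝ} {p : ℕ → ℕ → ℝ} {α A K cρ cs : ℝ}

theorem mean_sumRatio_sub_one_pow_le (Rs : RegularRates α A K cs s) (hα : 0 < α) (hA : 0 < A)
    (m : ℕ) {q C : ℝ} (hC : 0 < C)
    (h : ∀ᶠ n : ℕ in atTop,
      hitMean p n (fun j => (∑ k ∈ Finset.range j, ρ k - ∑ k ∈ Finset.range n, s k) ^ m)
        ≤ C * (n : ℝ) ^ ((α + 1) * m - q)) :
    ∃ D : ℝ, 0 < D ∧ ∀ᶠ n : ℕ in atTop,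
      hitMean p n (fun j => (sumRatio ρ s n j - 1) ^ m) ≤ D * (n : ℝ) ^ (- q) := by
  obtain ⟨D, hD0, hD⟩ := Rs.rpow_le_sum hα hA
  refine ⟨D ^ m * C, by positivity, ?_⟩
  filter_upwards [h, eventually_ne_atTop 0] with n hn hn0
  have hnp : (0 : ℝ) < n := by positivity
  have hg := Rs.sum_pos hn0
  have hDn := hD n
  set g := ∑ k ∈ Finset.range n, s k
  have e : (fun j => (sumRatio ρ s n j - 1) ^ m)
      = fun j => (1 / g) ^ m * (∑ k ∈ Finset.range j, ρ k - g) ^ m := by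
    funext j
    rw [sumRatio, ← mul_pow]
    congr 1
    change _ / g - 1 = _
    field_simp
  rw [e, mean_const_mul]
  have h1 : 1 / g ≤ D / (n : ℝ) ^ (α + 1) := by
    rw [div_le_div_iff₀ hg (by positivity)]; linarith
  calc (1 / g) ^ m * hitMean p n (fun j => (∑ k ∈ Finset.range j, ρ k - g) ^ m)
      ≤ (1 / g) ^ m * (C * (n : ℝ) ^ ((α + 1) * m - q)) := by gcongr
    _ ≤ (D / (n : ℝ) ^ (α + 1)) ^ m * (C * (n : ℝ) ^ ((α + 1) * m - q)) := by gcongr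
    _ = D ^ m * C * (n : ℝ) ^ (- q) := by
      rw [div_pow, ← Real.rpow_mul_natCast hnp.le, sub_eq_add_neg, Real.rpow_add hnp]
      field_simp

theorem mean_sumRatio_sub_one_sq_le (H : IsHitLaw ρ s p) (hα : 0 < α) (hA : 0 < A)
    (Rρ : RegularRates α A K cρ ρ) (Rs : RegularRates α A K cs s) :
    ∃ D : ℝ, 0 < D ∧ ∀ᶠ n : ℕ in atTop,
      hitMean p n (fun j => (sumRatio ρ s n j - 1) ^ 2) ≤ D / n := by
  obtain ⟨C, hC, h⟩ := H.second_moment_le hα hA Rρ Rs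
  obtain ⟨D, hD, h⟩ := mean_sumRatio_sub_one_pow_le (ρ := ρ) (p := p) Rs hα hA 2 (q := 1) hC
    (h.mono fun n hn => hn.trans (le_of_eq (by congr 2; push_cast; ring)))
  exact ⟨D, hD, h.mono fun n hn => hn.trans (le_of_eq (by rw [Real.rpow_neg_one]; rfl))⟩

theorem mean_sumRatio_sub_one_pow_four_le (H : IsHitLaw ρ s p) (hα : 0 < α) (hA : 0 < A)
    (Rρ : RegularRates α A K cρ ρ) (Rs : RegularRates α A K cs s) :
    ∃ D : ℝ, 0 < D ∧ ∀ᶠ n : ℕ in atTop,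
      hitMean p n (fun j => (sumRatio ρ s n j - 1) ^ 4) ≤ D / n ^ 2 := by
  obtain ⟨C, hC, h⟩ := H.fourth_moment_le hα hA Rρ Rs
  obtain ⟨D, hD, h⟩ := mean_sumRatio_sub_one_pow_le (ρ := ρ) (p := p) Rs hα hA 4 (q := 2) hC
    (h.mono fun n hn => hn.trans (le_of_eq (by congr 2; push_cast; ring)))
  exact ⟨D, hD, h.mono fun n hn => hn.trans (le_of_eq (by
    rw [Real.rpow_neg n.cast_nonneg, Real.rpow_two]; rfl))⟩

theorem polyGrowth_sumRatio (Rρ : RegularRates α A K cρ ρ) (hα : 0 < α) (n : ℕ) :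
    PolyGrowth (sumRatio ρ s n) :=
  ((Rρ.polyGrowth hα).sum_range).div_const _

theorem mean_sumRatio (H : IsHitLaw ρ s p) (hα : 0 < α)
    (Rρ : RegularRates α A K cρ ρ) (Rs : RegularRates α A K cs s) {n : ℕ} (hn : n ≠ 0) :
    hitMean p n (sumRatio ρ s n) = 1 := by
  have hg := (Rs.sum_pos hn).ne'
  have e : sumRatio ρ s n = fun j => (∑ k ∈ Finset.range n, s k)⁻¹ * ∑ k ∈ Finset.range j, ρ k := by
    funext j; rw [sumRatio]; ring
  rw [e, mean_const_mul, H.mean_sum_rho (Rρ.polyGrowth hα), inv_mul_cancel₀ hg]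

theorem tendsto_mean_sumRatio_sub_one_sq (H : IsHitLaw ρ s p) (hα : 0 < α) (hA : 0 < A)
    (Rρ : RegularRates α A K cρ ρ) (Rs : RegularRates α A K cs s) :
    Tendsto (fun n => hitMean p n (fun j => (sumRatio ρ s n j - 1) ^ 2)) atTop (nhds 0) := by
  obtain ⟨D, -, h⟩ := H.mean_sumRatio_sub_one_sq_le hα hA Rρ Rs
  refine tendsto_of_tendsto_of_tendsto_of_le_of_le' tendsto_const_nhds
    (tendsto_const_nhds.div_atTop tendsto_natCast_atTop_atTop)
    (Eventually.of_forall fun n => H.mean_nonneg n fun j => sq_nonneg _) h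

end IsHitLaw

theorem RegularRates.tendsto_sum_atTop {α A K c : ℝ} {x : ℕ → ℝ} (R : RegularRates α A K c x)
    (hα : 0 < α) (hA : 0 < A) :
    Tendsto (fun n => ∑ k ∈ Finset.range n, x k) atTop atTop := by
  have h1 : Tendsto (fun n : ℕ => (n : ℝ) ^ (α + 1)) atTop atTop :=
    (tendsto_rpow_atTop (by linarith)).comp tendsto_natCast_atTop_atTop
  refine (R.sum.pos_mul_atTop hA h1).congr' ?_
  filter_upwards [eventually_ne_atTop 0] with n hn
  have : (n : ℝ) ^ (α + 1) ≠ 0 := by positivity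
  field_simp

theorem RegularRates.tendsto_sq_sum_div_rpow {α A K c : ℝ} {x : ℕ → ℝ}
    (R : RegularRates α A K c x) (hα : 0 < α) (hA : 0 < A) :
    Tendsto (fun n => (∑ k ∈ Finset.range n, x k ^ 2) /
      (∑ k ∈ Finset.range n, x k) ^ ((2 * α + 1) / (α + 1))) atTop
      (nhds (K / A ^ ((2 * α + 1) / (α + 1)))) := by
  refine (R.sq_sum.div (R.sum.rpow_const (p := (2 * α + 1) / (α + 1)) (Or.inl hA.ne'))
    (by positivity)).congr' ?_
  filter_upwards [eventually_ne_atTop 0] with n hn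
  have hnp : (0 : ℝ) < n := by positivity
  simp only [Pi.div_apply]
  rw [Real.div_rpow (R.sum_nonneg n) (by positivity), ← Real.rpow_mul hnp.le,
    show (α + 1) * ((2 * α + 1) / (α + 1)) = 2 * α + 1 by field_simp]
  have := R.sum_pos hn
  have : (n : ℝ) ^ (2 * α + 1) ≠ 0 := by positivity
  field_simp

namespace IsHitLaw

variable {ρ s : ℕ → ℝ} {p : ℕ → ℕ → ℝ} {α A K cρ cs : ℝ}

theorem tendsto_mean_sq_sum_div (H : IsHitLaw ρ s p) (hα : 0 < α) (hA : 0 < A) (hK : 0 < K)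
    (Rρ : RegularRates α A K cρ ρ) (Rs : RegularRates α A K cs s) :
    Tendsto (fun n => hitMean p n (fun j => ∑ k ∈ Finset.range j, ρ k ^ 2) /
      (∑ k ∈ Finset.range n, s k) ^ ((2 * α + 1) / (α + 1))) atTop
      (nhds (K / A ^ ((2 * α + 1) / (α + 1)))) := by
  set γ := (2 * α + 1) / (α + 1) with hγ
  have hγ0 : 0 < γ := by positivity
  have hγ2 : γ ≤ 2 := by rw [hγ, div_le_iff₀ (by linarith)]; linarith
  set κ := K / A ^ γ with hκ
  have hκ0 : 0 < κ := by positivity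
  have hρ := Rρ.polyGrowth hα
  have hv := (hρ.pow 2).sum_range
  have hgtop : Tendsto (fun n => (∑ k ∈ Finset.range n, s k) ^ γ) atTop atTop :=
    (tendsto_rpow_atTop hγ0).comp (Rs.tendsto_sum_atTop hα hA)
  have key : Tendsto (fun n => hitMean p n (fun j => (∑ k ∈ Finset.range j, ρ k ^ 2) /
      (∑ k ∈ Finset.range n, s k) ^ γ - κ)) atTop (nhds 0) := by
    refine H.tendsto_mean_zero (D := fun n j => (sumRatio ρ s n j - 1) ^ 2) (fun n => ?_)
      (H.tendsto_mean_sumRatio_sub_one_sq hα hA Rρ Rs) fun ε hε => ?_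
    · have := polyGrowth_sumRatio (s := s) Rρ hα n
      fun_prop
    set δ := min 1 (ε / (κ + 3)) with hδ
    have hδ0 : 0 < δ := by positivity
    have hδ1 : δ ≤ 1 := min_le_left _ _
    have hδε : δ * (κ + 3) ≤ ε := by
      rw [← le_div_iff₀ (by positivity)]; exact min_le_right _ _
    obtain ⟨C, hC⟩ := exists_abs_le_mul_add_of_tendsto_div (Rρ.tendsto_sq_sum_div_rpow hα hA)
      ((eventually_ne_atTop 0).mono fun n hn => Real.rpow_pos_of_pos (Rρ.sum_pos hn) _)
      (fun n => Real.rpow_nonneg (Rρ.sum_nonneg n) _) hδ0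
    refine ⟨(δ + κ) * (1 / δ + 1), ?_⟩
    filter_upwards [eventually_ne_atTop 0, hgtop.eventually_ge_atTop (|C| / δ)] with n hn0 hgC j
    have hg := Rs.sum_pos hn0
    have hCj := hC j
    have hf := Rρ.sum_nonneg j
    have hU : sumRatio ρ s n j = (∑ k ∈ Finset.range j, ρ k) / ∑ k ∈ Finset.range n, s k := rfl
    set g := ∑ k ∈ Finset.range n, s k
    set f := ∑ k ∈ Finset.range j, ρ k
    set v := ∑ k ∈ Finset.range j, ρ k ^ 2
    set U := sumRatio ρ s n j
    have hU0 : 0 ≤ U := by rw [hU]; positivity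
    have hgγ : 0 < g ^ γ := by positivity
    have hUγ : U ^ γ = f ^ γ / g ^ γ := by rw [hU, Real.div_rpow hf hg.le]
    rw [← hγ, ← hκ] at hCj
    have t1 : |U ^ γ - 1| ≤ δ + (1 / δ + 1) * (U - 1) ^ 2 := by
      refine (abs_rpow_sub_one_le hU0 hγ0 hγ2).trans ?_
      rw [Real.rpow_two]
      have e : U ^ 2 - 1 = 2 * (U - 1) + (U - 1) ^ 2 := by ring
      have k1 : 2 * |U - 1| ≤ δ + 1 / δ * (U - 1) ^ 2 := by
        have : δ + 1 / δ * (U - 1) ^ 2 - 2 * |U - 1| = 1 / δ * (|U - 1| - δ) ^ 2 := by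
          rw [← sq_abs (U - 1)]; field_simp; ring
        have : 0 ≤ 1 / δ * (|U - 1| - δ) ^ 2 := by positivity
        linarith
      rw [e]
      refine (abs_add_le _ _).trans ?_
      rw [abs_mul, abs_of_pos (two_pos : (0 : ℝ) < 2), abs_of_nonneg (sq_nonneg (U - 1))]
      linarith
    have t2 : |v - κ * f ^ γ| / g ^ γ ≤ δ * U ^ γ + δ := by
      rw [div_le_iff₀ hgγ, add_mul, hUγ, mul_assoc, div_mul_cancel₀ _ hgγ.ne']
      refine hCj.trans ?_
      have := (div_le_iff₀ hδ0).1 hgC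
      linarith [le_abs_self C]
    have t3 : U ^ γ ≤ 1 + |U ^ γ - 1| := by linarith [le_abs_self (U ^ γ - 1)]
    have e : v / g ^ γ - κ = (v - κ * f ^ γ) / g ^ γ + κ * (U ^ γ - 1) := by
      rw [hUγ]; field_simp; ring
    rw [e]
    refine (abs_add_le _ _).trans ?_
    rw [abs_div, abs_of_pos hgγ, abs_mul, abs_of_pos hκ0]
    have t4 : (δ + κ) * |U ^ γ - 1| ≤ (δ + κ) * (δ + (1 / δ + 1) * (U - 1) ^ 2) := by gcongr
    have t5 : δ * U ^ γ ≤ δ * (1 + |U ^ γ - 1|) := by gcongr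
    nlinarith
  have := key.add_const κ
  rw [zero_add] at this
  refine this.congr fun n => ?_
  have e : (fun j => (∑ k ∈ Finset.range j, ρ k ^ 2) / (∑ k ∈ Finset.range n, s k) ^ γ - κ)
      = fun j => ((∑ k ∈ Finset.range n, s k) ^ γ)⁻¹ * (∑ k ∈ Finset.range j, ρ k ^ 2) - κ := by
    funext j; ring
  rw [e, H.mean_sub _ (by fun_prop) (by fun_prop), mean_const_mul, H.mean_const]
  ring

theorem tendsto_mul_mean_sumRatio_sub_one_sq (H : IsHitLaw ρ s p) (hα : 0 < α) (hA : 0 < A)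
    (hK : 0 < K) (Rρ : RegularRates α A K cρ ρ) (Rs : RegularRates α A K cs s) :
    Tendsto (fun n : ℕ => n * hitMean p n (fun j => (sumRatio ρ s n j - 1) ^ 2)) atTop
      (nhds (2 * K / A ^ 2)) := by
  have hρ := Rρ.polyGrowth hα
  have h1 := (Rs.tendsto_sq_sum_div_rpow hα hA).add (H.tendsto_mean_sq_sum_div hα hA hK Rρ Rs)
  have h2 := (Rs.sum.inv₀ hA.ne').rpow_const (p := 1 / (α + 1)) (Or.inl (by positivity))
  have h3 := h1.mul h2
  have e : (K / A ^ ((2 * α + 1) / (α + 1)) + K / A ^ ((2 * α + 1) / (α + 1)))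
      * A⁻¹ ^ (1 / (α + 1)) = 2 * K / A ^ 2 := by
    have : A ^ 2 = A ^ ((2 * α + 1) / (α + 1)) * A ^ (1 / (α + 1)) := by
      rw [← Real.rpow_add hA, ← Real.rpow_two]; congr 1; field_simp; ring
    rw [this, Real.inv_rpow hA.le]
    have := (Real.rpow_pos_of_pos hA ((2 * α + 1) / (α + 1))).ne'
    have := (Real.rpow_pos_of_pos hA (1 / (α + 1))).ne'
    field_simp
    ring
  rw [e] at h3
  refine h3.congr' ?_
  filter_upwards [eventually_ne_atTop 0] with n hn0
  have hnp : (0 : ℝ) < n := by positivity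
  have hg := Rs.sum_pos hn0
  have hsq := H.mean_sq_sum_rho hρ n
  set g := ∑ k ∈ Finset.range n, s k
  have e1 : (fun j => (sumRatio ρ s n j - 1) ^ 2)
      = fun j => (1 / g) ^ 2 * (∑ k ∈ Finset.range j, ρ k - g) ^ 2 := by
    funext j
    rw [sumRatio, ← mul_pow]
    congr 1
    change _ / g - 1 = _
    field_simp
  rw [e1, mean_const_mul, hsq, inv_div, Real.div_rpow (by positivity) hg.le,
    ← Real.rpow_mul hnp.le, show (α + 1) * (1 / (α + 1)) = 1 by field_simp, Real.rpow_one]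
  have e2 : g ^ 2 = g ^ ((2 * α + 1) / (α + 1)) * g ^ (1 / (α + 1)) := by
    rw [← Real.rpow_add hg, ← Real.rpow_two]; congr 1; field_simp; ring
  rw [div_pow, e2]
  have := (Real.rpow_pos_of_pos hg ((2 * α + 1) / (α + 1))).ne'
  have := (Real.rpow_pos_of_pos hg (1 / (α + 1))).ne'
  field_simp

theorem tendsto_mean_zero_of_tendsto (H : IsHitLaw ρ s p) (hα : 0 < α) (hA : 0 < A)
    (Rρ : RegularRates α A K cρ ρ) (Rs : RegularRates α A K cs s) {η : ℕ → ℝ}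
    (hη : Tendsto η atTop (nhds 0)) :
    Tendsto (fun n => hitMean p n η) atTop (nhds 0) := by
  refine H.tendsto_mean_zero (φ := fun _ => η) (D := fun n j => (sumRatio ρ s n j - 1) ^ 2)
    (fun n => ?_) (H.tendsto_mean_sumRatio_sub_one_sq hα hA Rρ Rs) fun ε hε => ?_
  · have := polyGrowth_sumRatio (s := s) Rρ hα n
    fun_prop
  obtain ⟨J, hJ⟩ := eventually_atTop.1 (Metric.tendsto_nhds.1 hη ε hε)
  set M := ∑ k ∈ Finset.range J, |η k| with hM
  have hM0 : 0 ≤ M := Finset.sum_nonneg fun k _ => abs_nonneg _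
  refine ⟨4 * M, ?_⟩
  filter_upwards [eventually_ne_atTop 0, (Rs.tendsto_sum_atTop hα hA).eventually_ge_atTop
    (2 * ∑ k ∈ Finset.range J, ρ k)] with n hn0 hn j
  have hg := Rs.sum_pos hn0
  rcases lt_or_ge j J with h | h
  · have h1 : |η j| ≤ M := Finset.single_le_sum (f := fun k => |η k|) (fun k _ => abs_nonneg _)
      (Finset.mem_range.2 h)
    have h2 : sumRatio ρ s n j ≤ 1 / 2 := by
      rw [sumRatio, div_le_div_iff₀ hg (by norm_num)]
      have : ∑ k ∈ Finset.range j, ρ k ≤ ∑ k ∈ Finset.range J, ρ k :=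
        Finset.sum_le_sum_of_subset_of_nonneg (Finset.range_mono h.le) fun k _ _ => (Rρ.pos k).le
      linarith
    have h3 : 1 ≤ 4 * (sumRatio ρ s n j - 1) ^ 2 := by nlinarith
    nlinarith
  · have h1 := hJ j h
    rw [Real.dist_eq, sub_zero] at h1
    have : 0 ≤ 4 * M * (sumRatio ρ s n j - 1) ^ 2 := by positivity
    linarith

theorem tendsto_mul_mean_rpow (H : IsHitLaw ρ s p) (hα : 0 < α) (hA : 0 < A) (hK : 0 < K)
    (Rρ : RegularRates α A K cρ ρ) (Rs : RegularRates α A K cs s) {q : ℝ} (hq0 : 0 < q)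
    (hq1 : q < 1) :
    Tendsto (fun n : ℕ => n * (hitMean p n (fun j => sumRatio ρ s n j ^ q) - 1)) atTop
      (nhds (q * (q - 1) * K / A ^ 2)) := by
  obtain ⟨D₂, hD₂, h₂⟩ := H.mean_sumRatio_sub_one_sq_le hα hA Rρ Rs
  obtain ⟨D₄, hD₄, h₄⟩ := H.mean_sumRatio_sub_one_pow_four_le hα hA Rρ Rs
  have hpg := fun n => polyGrowth_sumRatio (s := s) Rρ hα n
  have hU0 : ∀ n j, 0 ≤ sumRatio ρ s n j := fun n j =>
    div_nonneg (Rρ.sum_nonneg j) (Rs.sum_nonneg n)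
  have hpq := fun n => (hpg n).rpow (hU0 n) hq0.le
  have herr : Tendsto (fun n : ℕ => n * hitMean p n (fun j => sumRatio ρ s n j ^ q -
      (1 + q * (sumRatio ρ s n j - 1) + q * (q - 1) / 2 * (sumRatio ρ s n j - 1) ^ 2)))
      atTop (nhds 0) := by
    rw [Metric.tendsto_nhds]
    intro ε hε
    obtain ⟨C, hC0, hC⟩ := exists_rpow_taylor_le hq0 hq1 (ε := ε / (2 * D₂)) (by positivity)
    have hlim : Tendsto (fun n : ℕ => C * D₄ / (n : ℝ)) atTop (nhds 0) :=
      tendsto_const_nhds.div_atTop tendsto_natCast_atTop_atTop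
    filter_upwards [h₂, h₄, eventually_ne_atTop 0,
      hlim.eventually (gt_mem_nhds (half_pos hε))] with n hn₂ hn₄ hn0 hnε
    have hnp : (0 : ℝ) < n := by positivity
    have hpn := hpg n
    have := H.abs_mean_le n (ψ := fun j => ε / (2 * D₂) * (sumRatio ρ s n j - 1) ^ 2
      + C * (sumRatio ρ s n j - 1) ^ 4) (by fun_prop) fun j => hC _ (hU0 n j)
    rw [H.mean_add _ (by fun_prop) (by fun_prop), mean_const_mul, mean_const_mul] at this
    rw [Real.dist_eq, sub_zero, abs_mul, abs_of_pos hnp]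
    calc (n : ℝ) * _ ≤ n * (ε / (2 * D₂) * (D₂ / n) + C * (D₄ / n ^ 2)) := by
          gcongr
          refine this.trans ?_
          gcongr
      _ = ε / 2 + C * D₄ / n := by field_simp
      _ < ε := by linarith
  have hmain := herr.add ((H.tendsto_mul_mean_sumRatio_sub_one_sq hα hA hK Rρ Rs).const_mul
    (q * (q - 1) / 2))
  have e : 0 + q * (q - 1) / 2 * (2 * K / A ^ 2) = q * (q - 1) * K / A ^ 2 := by ring
  rw [e] at hmain
  refine hmain.congr' ?_
  filter_upwards [eventually_ne_atTop 0] with n hn0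
  have hpn := hpg n
  have hpqn := hpq n
  rw [H.mean_sub _ (by fun_prop) (by fun_prop), H.mean_add _ (by fun_prop) (by fun_prop),
    H.mean_add _ (by fun_prop) (by fun_prop), mean_const_mul, mean_const_mul,
    H.mean_sub _ (by fun_prop) (by fun_prop), H.mean_const, H.mean_sumRatio hα Rρ Rs hn0]
  ring

/-- The asymptotic mean number of red balls at the `n`-th blue draw. -/
theorem tendsto_mean_sub (H : IsHitLaw ρ s p) (hα : 0 < α) (hA : 0 < A) (hK : 0 < K)
    (Rρ : RegularRates α A K cρ ρ) (Rs : RegularRates α A K cs s) :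
    Tendsto (fun n : ℕ => hitMean p n (fun j => (j : ℝ)) - n) atTop
      (nhds (cs - cρ + 1 / (α + 1) * (1 / (α + 1) - 1) * K / A ^ 2)) := by
  set q := 1 / (α + 1) with hq
  have hq0 : 0 < q := by positivity
  have hq1 : q < 1 := by rw [hq, div_lt_one (by linarith)]; linarith
  have hf := (Rρ.polyGrowth hα).sum_range
  have hη : Tendsto (fun j : ℕ => ((∑ k ∈ Finset.range j, ρ k) / A) ^ q - (j : ℝ) - cρ) atTop
      (nhds 0) := by
    have := Rρ.root.sub_const cρ
    rw [sub_self] at this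
    exact this
  have hE := H.tendsto_mean_zero_of_tendsto hα hA Rρ Rs hη
  have hr : Tendsto (fun n : ℕ => ((∑ k ∈ Finset.range n, s k) / A) ^ q / (n : ℝ)) atTop
      (nhds 1) := by
    have h0 : Tendsto (fun n : ℕ => (((∑ k ∈ Finset.range n, s k) / A) ^ q - (n : ℝ)) / n) atTop
        (nhds 0) := Rs.root.div_atTop tendsto_natCast_atTop_atTop
    have := h0.add_const 1
    rw [zero_add] at this
    refine this.congr' ?_
    filter_upwards [eventually_ne_atTop 0] with n hn
    have : (n : ℝ) ≠ 0 := by positivity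
    field_simp
    ring
  have hlim := ((Rs.root.sub_const cρ).add
    (hr.mul (H.tendsto_mul_mean_rpow hα hA hK Rρ Rs hq0 hq1))).sub hE
  rw [one_mul, sub_zero] at hlim
  refine hlim.congr' ?_
  filter_upwards [eventually_ne_atTop 0] with n hn0
  have hnp : (0 : ℝ) < n := by positivity
  have hg := Rs.sum_pos hn0
  have hpow : PolyGrowth fun j => ((∑ k ∈ Finset.range j, ρ k) / A) ^ q :=
    (hf.div_const A).rpow (fun j => div_nonneg (Rρ.sum_nonneg j) hA.le) hq0.le
  have e1 : hitMean p n (fun j => ((∑ k ∈ Finset.range j, ρ k) / A) ^ q)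
      = ((∑ k ∈ Finset.range n, s k) / A) ^ q * hitMean p n (fun j => sumRatio ρ s n j ^ q) := by
    rw [← mean_const_mul]
    congr 1
    funext j
    rw [sumRatio, ← Real.mul_rpow (by positivity) (div_nonneg (Rρ.sum_nonneg j) hg.le)]
    congr 1
    field_simp
  rw [H.mean_sub _ (by fun_prop) (by fun_prop), H.mean_sub _ hpow (by fun_prop), H.mean_const, e1]
  field_simp
  ring

end IsHitLaw

theorem tendsto_one_div_natCast_nhdsNE :
    Tendsto (fun n : ℕ => 1 / (n : ℝ)) atTop (nhdsWithin 0 {0}ᶜ) := by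
  refine tendsto_nhdsWithin_iff.2 ⟨tendsto_one_div_atTop_nhds_zero_nat, ?_⟩
  filter_upwards [eventually_ne_atTop 0] with n hn
  simpa using hn

theorem tendsto_rpow_first_order (q : ℝ) :
    Tendsto (fun x : ℝ => ((1 + x) ^ q - 1) / x) (nhdsWithin 0 {0}ᶜ) (nhds q) := by
  have h1 : Tendsto (fun x : ℝ => x) (nhdsWithin 0 {0}ᶜ) (nhds 0) :=
    tendsto_id.mono_left nhdsWithin_le_nhds
  have h := ((tendsto_rpow_second_order q).mul h1).add_const q
  rw [mul_zero, zero_add] at h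
  refine h.congr' ?_
  filter_upwards [self_mem_nhdsWithin] with x hx
  have : x ≠ 0 := hx
  field_simp
  ring

theorem add_one_rpow_eq {n : ℕ} (hn : n ≠ 0) (p : ℝ) :
    ((n : ℝ) + 1) ^ p = (n : ℝ) ^ p * (1 + 1 / (n : ℝ)) ^ p := by
  have : (0 : ℝ) < n := by positivity
  rw [← Real.mul_rpow this.le (by positivity)]
  congr 1
  field_simp

theorem tendsto_rpow_succ_sub_div (p : ℝ) :
    Tendsto (fun n : ℕ => (((n : ℝ) + 1) ^ p - (n : ℝ) ^ p) / (n : ℝ) ^ (p - 1)) atTop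
      (nhds p) := by
  refine ((tendsto_rpow_first_order p).comp tendsto_one_div_natCast_nhdsNE).congr' ?_
  filter_upwards [eventually_ne_atTop 0] with n hn
  have hn0 : (0 : ℝ) < n := by positivity
  have : (n : ℝ) ^ p ≠ 0 := by positivity
  rw [add_one_rpow_eq hn, Real.rpow_sub_one hn0.ne']
  simp only [Function.comp]
  field_simp

theorem sum_rpow_succ_sub {p : ℝ} (hp : 0 < p) (n : ℕ) :
    ∑ k ∈ Finset.range n, (((k : ℝ) + 1) ^ p - (k : ℝ) ^ p) = (n : ℝ) ^ p := by
  have := Finset.sum_range_sub (fun k : ℕ => (k : ℝ) ^ p) n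
  simpa [Real.zero_rpow hp.ne'] using this

/-- Cesàro summation against power weights. -/
theorem tendsto_sum_div_rpow {a : ℕ → ℝ} {p l : ℝ} (hp : 0 < p)
    (h : Tendsto (fun n : ℕ => a n / (n : ℝ) ^ (p - 1)) atTop (nhds l)) :
    Tendsto (fun n : ℕ => (∑ k ∈ Finset.range n, a k) / (n : ℝ) ^ p) atTop (nhds (l / p)) := by
  set g : ℕ → ℝ := fun n => ((n : ℝ) + 1) ^ p - (n : ℝ) ^ p with hg
  have hgpos : ∀ n, 0 < g n := fun n =>
    sub_pos.2 (Real.rpow_lt_rpow (by positivity) (by linarith) hp)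
  have hag : Tendsto (fun n => a n / g n) atTop (nhds (l / p)) := by
    refine (h.div (tendsto_rpow_succ_sub_div p) hp.ne').congr' ?_
    filter_upwards [eventually_ne_atTop 0] with n hn
    have h1 := hgpos n
    have : (n : ℝ) ^ (p - 1) ≠ 0 := by positivity
    simp only [Pi.div_apply]
    exact div_div_div_cancel_right₀ this _ _
  have ho : (fun n => a n - l / p * g n) =o[atTop] g := by
    rw [Asymptotics.isLittleO_iff_tendsto fun n hn => absurd hn (hgpos n).ne']
    have := hag.sub_const (l / p)
    rw [sub_self] at this
    refine this.congr fun n => ?_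
    have := hgpos n
    field_simp
  have htop : Tendsto (fun n : ℕ => (n : ℝ) ^ p) atTop atTop :=
    (tendsto_rpow_atTop hp).comp tendsto_natCast_atTop_atTop
  have hs := ho.sum_range (fun n => (hgpos n).le)
    (by simpa only [hg, sum_rpow_succ_sub hp] using htop)
  simp only [Finset.sum_sub_distrib, ← Finset.mul_sum, hg, sum_rpow_succ_sub hp] at hs
  have := hs.tendsto_div_nhds_zero.add_const (l / p)
  rw [zero_add] at this
  refine this.congr' ?_
  filter_upwards [eventually_ne_atTop 0] with n hn
  have : (n : ℝ) ^ p ≠ 0 := by positivity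
  field_simp
  ring

theorem tendsto_sub_rpow_succ_sub {x : ℕ → ℝ} {α a b : ℝ} (hα : 0 < α)
    (h : Tendsto (fun n : ℕ => (x n - a * (n : ℝ) ^ α) / (n : ℝ) ^ (α - 1)) atTop (nhds b)) :
    Tendsto (fun n : ℕ => (x n - a / (α + 1) * (((n : ℝ) + 1) ^ (α + 1) - (n : ℝ) ^ (α + 1))) /
      (n : ℝ) ^ (α - 1)) atTop (nhds (b - a * α / 2)) := by
  have h2 := ((tendsto_rpow_second_order (α + 1)).comp tendsto_one_div_natCast_nhdsNE).const_mul
    (a / (α + 1))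
  have h3 := h.sub h2
  rw [show a / (α + 1) * ((α + 1) * (α + 1 - 1) / 2) = a * α / 2 by field_simp; ring] at h3
  refine h3.congr' ?_
  filter_upwards [eventually_ne_atTop 0] with n hn
  have hn0 : (0 : ℝ) < n := by positivity
  have h4 : (n : ℝ) ^ α ≠ 0 := by positivity
  rw [add_one_rpow_eq hn, Real.rpow_sub_one hn0.ne', Real.rpow_add_one hn0.ne']
  simp only [Function.comp]
  field_simp
  ring

theorem tendsto_rpow_sub_natCast {F : ℕ → ℝ} {A c q : ℝ} (hA : 0 < A) (hq : 0 < q)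
    (hF : ∀ n, 0 ≤ F n)
    (h : Tendsto (fun n : ℕ => (F n - A * (n : ℝ) ^ (1 / q)) / (n : ℝ) ^ (1 / q - 1)) atTop
      (nhds c)) :
    Tendsto (fun n : ℕ => (F n / A) ^ q - (n : ℝ)) atTop (nhds (q * (c / A))) := by
  have hu : Tendsto (fun n : ℕ => (n : ℝ) * (F n / (A * (n : ℝ) ^ (1 / q)) - 1)) atTop
      (nhds (c / A)) := by
    refine (h.div_const A).congr' ?_
    filter_upwards [eventually_ne_atTop 0] with n hn
    have hn0 : (0 : ℝ) < n := by positivity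
    have h4 : (n : ℝ) ^ (1 / q) ≠ 0 := by positivity
    rw [Real.rpow_sub_one hn0.ne']
    field_simp
  have hu0 : Tendsto (fun n : ℕ => F n / (A * (n : ℝ) ^ (1 / q)) - 1) atTop (nhds 0) := by
    have := hu.mul tendsto_one_div_atTop_nhds_zero_nat
    rw [mul_zero] at this
    refine this.congr' ?_
    filter_upwards [eventually_ne_atTop 0] with n hn
    have hn0 : (0 : ℝ) < n := by positivity
    field_simp
  have hd : HasDerivAt (fun x : ℝ => (1 + x) ^ q) q 0 := by
    have := ((hasDerivAt_id (0 : ℝ)).const_add 1).rpow_const (p := q) (by simp)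
    simpa using this
  have hds : ContinuousAt (dslope (fun x : ℝ => (1 + x) ^ q) 0) 0 :=
    continuousAt_dslope_same.2 hd.differentiableAt
  have hl := (hds.tendsto.comp hu0).mul hu
  rw [dslope_same, hd.deriv] at hl
  refine hl.congr' ?_
  filter_upwards [eventually_ne_atTop 0] with n hn
  have hn0 : (0 : ℝ) < n := by positivity
  have h4 : (0 : ℝ) < (n : ℝ) ^ (1 / q) := by positivity
  have h5 := sub_smul_dslope (fun x : ℝ => (1 + x) ^ q) 0 (F n / (A * (n : ℝ) ^ (1 / q)) - 1)
  simp only [smul_eq_mul, sub_zero, add_zero, Real.one_rpow, add_sub_cancel] at h5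
  have h6 : (F n / (A * (n : ℝ) ^ (1 / q))) ^ q = (F n / A) ^ q / n := by
    rw [← div_div, Real.div_rpow (div_nonneg (hF n) hA.le) h4.le, ← Real.rpow_mul hn0.le,
      one_div_mul_cancel hq.ne', Real.rpow_one]
  rw [h6] at h5
  simp only [Function.comp]
  calc _ = (n : ℝ) * ((F n / (A * (n : ℝ) ^ (1 / q)) - 1) *
        dslope (fun x : ℝ => (1 + x) ^ q) 0 (F n / (A * (n : ℝ) ^ (1 / q)) - 1)) := by ring
    _ = _ := by rw [h5]; field_simp

theorem tendsto_div_rpow_of_expansion {x : ℕ → ℝ} {α a b : ℝ}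
    (h : Tendsto (fun n : ℕ => (x n - a * (n : ℝ) ^ α) / (n : ℝ) ^ (α - 1)) atTop (nhds b)) :
    Tendsto (fun n : ℕ => x n / (n : ℝ) ^ α) atTop (nhds a) := by
  have := (h.mul tendsto_one_div_atTop_nhds_zero_nat).add_const a
  rw [mul_zero, zero_add] at this
  refine this.congr' ?_
  filter_upwards [eventually_ne_atTop 0] with n hn
  have hn0 : (0 : ℝ) < n := by positivity
  have h4 : (n : ℝ) ^ α ≠ 0 := by positivity
  rw [Real.rpow_sub_one hn0.ne']
  field_simp
  ring

/-- Rates with a two-term power expansion are regular. -/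
theorem regularRates_of_expansion {x : ℕ → ℝ} {α a b : ℝ} (hα : 0 < α) (ha : 0 < a)
    (hx : ∀ n, 0 < x n)
    (h : Tendsto (fun n : ℕ => (x n - a * (n : ℝ) ^ α) / (n : ℝ) ^ (α - 1)) atTop (nhds b)) :
    RegularRates α (a / (α + 1)) (a ^ 2 / (2 * α + 1)) (b / (a * α) - 1 / 2) x where
  pos := hx
  bound := by
    refine exists_le_mul_of_tendsto_div (l := a) ?_ (fun n => by positivity)
      fun n hn => absurd hn (by positivity)
    have h1 := (tendsto_rpow_succ_sub_div α).mul tendsto_one_div_atTop_nhds_zero_nat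
    have h2 := (tendsto_div_rpow_of_expansion h).div (h1.add_const 1) (by norm_num)
    rw [mul_zero, zero_add, div_one] at h2
    refine h2.congr' ?_
    filter_upwards [eventually_ne_atTop 0] with n hn
    have hn0 : (0 : ℝ) < n := by positivity
    have h4 : (0 : ℝ) < (n : ℝ) ^ α := by positivity
    have h5 : (0 : ℝ) < ((n : ℝ) + 1) ^ α := by positivity
    simp only [Pi.div_apply]
    rw [Real.rpow_sub_one hn0.ne']
    field_simp
    ring_nf
  sum := tendsto_sum_div_rpow (by linarith)
    (by simpa only [add_sub_cancel_right] using tendsto_div_rpow_of_expansion h)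
  sq_sum := by
    refine tendsto_sum_div_rpow (by linarith) ?_
    refine ((tendsto_div_rpow_of_expansion h).pow 2).congr fun n => ?_
    rw [add_sub_cancel_right, div_pow, mul_comm 2 α, Real.rpow_mul (by positivity), Real.rpow_two]
  root := by
    have hc := tendsto_sum_div_rpow hα (tendsto_sub_rpow_succ_sub hα h)
    simp only [Finset.sum_sub_distrib, ← Finset.mul_sum,
      sum_rpow_succ_sub (show 0 < α + 1 by linarith)] at hc
    have := tendsto_rpow_sub_natCast (A := a / (α + 1)) (q := 1 / (α + 1)) (by positivity)
      (by positivity) (fun n => Finset.sum_nonneg fun k _ => (hx k).le)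
      (by simpa only [one_div_one_div, add_sub_cancel_right] using hc)
    convert this using 2
    field_simp

theorem WeightAsymp.tendsto_expansion {w : ℕ → ℝ} {α B : ℝ} (hw : WeightAsymp w α B) :
    Tendsto (fun n : ℕ => (1 / w n - (n : ℝ) ^ α) / (n : ℝ) ^ (α - 1)) atTop (nhds (2 * B)) := by
  obtain ⟨C, hC, N, hN⟩ := hw
  rw [tendsto_iff_norm_sub_tendsto_zero]
  have h0 := (tendsto_one_div_atTop_nhds_zero_nat (𝕜 := ℝ)).const_mul C
  rw [mul_zero] at h0
  refine squeeze_zero' (Eventually.of_forall fun n => norm_nonneg _) ?_ h0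
  filter_upwards [eventually_ge_atTop N, eventually_ne_atTop 0] with n hn hn1
  have hn0 : (0 : ℝ) < n := by positivity
  have h4 : (0 : ℝ) < (n : ℝ) ^ (α - 1) := by positivity
  have e : (1 / w n - (n : ℝ) ^ α) / (n : ℝ) ^ (α - 1) - 2 * B
      = (1 / w n - (n : ℝ) ^ α - 2 * B * (n : ℝ) ^ (α - 1)) / (n : ℝ) ^ (α - 1) := by
    field_simp
  rw [e, Real.norm_eq_abs, abs_div, abs_of_pos h4, div_le_iff₀ h4]
  refine (hN n hn).trans_eq ?_
  rw [show α - 2 = α - 1 - 1 by ring, Real.rpow_sub_one hn0.ne' (α - 1)]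
  ring

theorem WeightAsymp.tendsto_even {w : ℕ → ℝ} {α B : ℝ} (hw : WeightAsymp w α B) :
    Tendsto (fun n : ℕ => (1 / w (2 * n) - 2 ^ α * (n : ℝ) ^ α) / (n : ℝ) ^ (α - 1)) atTop
      (nhds (2 ^ α * B)) := by
  have h1 := (hw.tendsto_expansion.comp
    (tendsto_id.const_mul_atTop' (r := 2) (by norm_num))).mul_const ((2 : ℝ) ^ (α - 1))
  rw [Real.rpow_sub_one (by norm_num), show 2 * B * (2 ^ α / 2) = 2 ^ α * B by ring] at h1
  refine h1.congr' ?_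
  filter_upwards [eventually_ne_atTop 0] with n hn
  have hn0 : (0 : ℝ) < n := by positivity
  simp only [Function.comp, id]
  push_cast
  rw [Real.mul_rpow (by norm_num) hn0.le, Real.mul_rpow (by norm_num) hn0.le,
    Real.rpow_sub_one (by norm_num)]
  have : (0 : ℝ) < (n : ℝ) ^ (α - 1) := by positivity
  have : (0 : ℝ) < (2 : ℝ) ^ α := by positivity
  field_simp

theorem WeightAsymp.tendsto_odd {w : ℕ → ℝ} {α B : ℝ} (hw : WeightAsymp w α B) :
    Tendsto (fun n : ℕ => (1 / w (2 * n + 1) - 2 ^ α * (n : ℝ) ^ α) / (n : ℝ) ^ (α - 1)) atTop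
      (nhds (2 ^ α * B + 2 ^ α * α / 2)) := by
  have hhalf : Tendsto (fun n : ℕ => 1 / (n : ℝ) / 2) atTop (nhdsWithin 0 {0}ᶜ) := by
    refine tendsto_nhdsWithin_iff.2 ⟨?_, ?_⟩
    · simpa using (tendsto_one_div_atTop_nhds_zero_nat (𝕜 := ℝ)).div_const 2
    · filter_upwards [eventually_ne_atTop 0] with n hn
      simpa using hn
  have hodd : Tendsto (fun n : ℕ => 2 * n + 1) atTop atTop :=
    tendsto_atTop_mono (fun n => by simp only [id]; omega) tendsto_id
  have hhalf0 : Tendsto (fun n : ℕ => 1 / (n : ℝ) / 2) atTop (nhds 0) :=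
    hhalf.mono_right nhdsWithin_le_nhds
  have hratio : Tendsto (fun n : ℕ => 2 ^ (α - 1) * (1 + 1 / (n : ℝ) / 2) ^ (α - 1)) atTop
      (nhds (2 ^ (α - 1))) := by
    have := ((hhalf0.const_add 1).rpow_const (p := α - 1) (Or.inl (by norm_num))).const_mul
      ((2 : ℝ) ^ (α - 1))
    simpa using this
  have h1 := (hw.tendsto_expansion.comp hodd).mul hratio
  have h2 := ((tendsto_rpow_first_order α).comp hhalf).const_mul ((2 : ℝ) ^ α / 2)
  have h3 := h1.add h2
  rw [show 2 * B * 2 ^ (α - 1) + 2 ^ α / 2 * α = 2 ^ α * B + 2 ^ α * α / 2 by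
    rw [Real.rpow_sub_one (by norm_num)]; ring] at h3
  refine h3.congr' ?_
  filter_upwards [eventually_ne_atTop 0] with n hn
  have hn0 : (0 : ℝ) < n := by positivity
  have key : ∀ p : ℝ, (2 * (n : ℝ) + 1) ^ p = 2 ^ p * (n : ℝ) ^ p * (1 + 1 / (n : ℝ) / 2) ^ p := by
    intro p
    rw [← Real.mul_rpow (by norm_num) hn0.le, ← Real.mul_rpow (by positivity) (by positivity)]
    congr 1
    field_simp
  simp only [Function.comp]
  push_cast
  rw [key α, key (α - 1)]
  have h5 : (0 : ℝ) < (1 + 1 / (n : ℝ) / 2) ^ (α - 1) := by positivity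
  have h6 : (0 : ℝ) < (2 : ℝ) ^ (α - 1) := by positivity
  have h7 : (0 : ℝ) < (n : ℝ) ^ (α - 1) := by positivity
  have h8 : (n : ℝ) ^ α = (n : ℝ) ^ (α - 1) * n := by
    rw [Real.rpow_sub_one hn0.ne']; field_simp
  rw [h8]
  set X := (1 + 1 / (n : ℝ) / 2) ^ (α - 1)
  set Y := (1 + 1 / (n : ℝ) / 2) ^ α
  field_simp
  ring

theorem WeightAsymp.tendsto_inv_atTop {w : ℕ → ℝ} {α B : ℝ} (hα : 0 < α)
    (hw : WeightAsymp w α B) : Tendsto (fun n : ℕ => 1 / w (2 * n)) atTop atTop := by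
  have h := (tendsto_div_rpow_of_expansion hw.tendsto_even).pos_mul_atTop
    (Real.rpow_pos_of_pos two_pos α)
    ((tendsto_rpow_atTop hα).comp tendsto_natCast_atTop_atTop)
  refine h.congr' ?_
  filter_upwards [eventually_ne_atTop 0] with n hn
  have : (n : ℝ) ^ α ≠ 0 := by positivity
  simp only [Function.comp]
  field_simp

namespace Urn

variable {Ω : Type*} [MeasurableSpace Ω] {μ : Measure Ω} {b r : ℕ → ℝ}

theorem Bl_add_Re (U : Urn μ b r) (n : ℕ) (ω : Ω) : U.Bl n ω + U.Re n ω = n := by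
  induction n with
  | zero => simp [U.init_Bl, U.init_Re]
  | succ n ih => rcases U.step n ω with ⟨h1, h2⟩ | ⟨h1, h2⟩ <;> omega

theorem Bl_succ (U : Urn μ b r) (n : ℕ) (ω : Ω) :
    U.Bl (n + 1) ω = U.Bl n ω + 1 ∨ U.Bl (n + 1) ω = U.Bl n ω :=
  (U.step n ω).imp And.left And.left

theorem Bl_le (U : Urn μ b r) (n : ℕ) (ω : Ω) : U.Bl n ω ≤ n := by
  have := U.Bl_add_Re n ω
  omega

theorem Bl_mono (U : Urn μ b r) (ω : Ω) : Monotone fun n => U.Bl n ω :=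
  monotone_nat_of_le_succ fun n => by rcases U.Bl_succ n ω with h | h <;> simp only [h] <;> omega

/-- The event that the `(n + 1)`-st blue ball is drawn after exactly `j` red balls. -/
def hit (U : Urn μ b r) (n j : ℕ) : Set Ω :=
  {ω | U.Bl (n + j) ω = n ∧ U.Bl (n + j + 1) ω = n + 1}

/-- The event that `n` blue and `j` red balls have been drawn at time `n + j`. -/
def visit (U : Urn μ b r) (n j : ℕ) : Set Ω := {ω | U.Bl (n + j) ω = n}

theorem measurableSet_visit (U : Urn μ b r) (n j : ℕ) : MeasurableSet (U.visit n j) :=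
  U.meas_Bl (n + j) (measurableSet_singleton n)

theorem measurableSet_hit (U : Urn μ b r) (n j : ℕ) : MeasurableSet (U.hit n j) :=
  (U.meas_Bl (n + j) (measurableSet_singleton n)).inter
    (U.meas_Bl (n + j + 1) (measurableSet_singleton (n + 1)))

theorem hit_subset_visit (U : Urn μ b r) (n j : ℕ) : U.hit n j ⊆ U.visit n j := fun _ h => h.1

theorem F_le (U : Urn μ b r) (n : ℕ) : U.F n ≤ ‹MeasurableSpace Ω› :=
  iSup₂_le fun j _ => ((U.meas_Bl j).prodMk (U.meas_Re j)).comap_le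

theorem measurableSet_F_visit (U : Urn μ b r) (n j : ℕ) :
    MeasurableSet[U.F (n + j)] (U.visit n j) := by
  have h : MeasurableSpace.comap (fun ω => (U.Bl (n + j) ω, U.Re (n + j) ω)) inferInstance
      ≤ U.F (n + j) :=
    le_iSup₂_of_le (f := fun i (_ : i ∈ Set.Iic (n + j)) =>
      MeasurableSpace.comap (fun ω => (U.Bl i ω, U.Re i ω)) inferInstance)
      (n + j) (Set.mem_Iic.2 le_rfl) le_rfl
  exact h _ ⟨{x | x.1 = n}, measurable_fst (measurableSet_singleton n), rfl⟩

theorem measureReal_hit (U : Urn μ b r) [IsProbabilityMeasure μ] (n j : ℕ) :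
    μ.real (U.hit n j) = b n / (b n + r j) * μ.real (U.visit n j) := by
  have hmeas : Measurable fun ω =>
      if U.Bl (n + j + 1) ω = U.Bl (n + j) ω + 1 then (1 : ℝ) else 0 :=
    Measurable.ite (measurableSet_eq_fun (U.meas_Bl _) ((U.meas_Bl _).add_const 1))
      measurable_const measurable_const
  have hF_int : Integrable (fun ω =>
      if U.Bl (n + j + 1) ω = U.Bl (n + j) ω + 1 then (1 : ℝ) else 0) μ :=
    Integrable.of_bound hmeas.aestronglyMeasurable 1
      (Eventually.of_forall fun ω => by split_ifs <;> simp)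
  have h := setIntegral_condExp (U.F_le (n + j)) hF_int (U.measurableSet_F_visit n j)
  have h1 : ∫ ω in U.visit n j, (if U.Bl (n + j + 1) ω = U.Bl (n + j) ω + 1 then (1 : ℝ) else 0) ∂μ
      = μ.real (U.hit n j) := by
    rw [← integral_indicator (U.measurableSet_visit n j),
      ← integral_indicator_one (U.measurableSet_hit n j)]
    congr 1
    ext ω
    simp only [Set.indicator, visit, hit, Set.mem_ofPred_eq, Pi.one_apply]
    by_cases h2 : U.Bl (n + j) ω = n <;> simp [h2]
  have h3 : ∫ ω in U.visit n j, (μ[(fun ω =>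
        if U.Bl (n + j + 1) ω = U.Bl (n + j) ω + 1 then (1 : ℝ) else 0) | U.F (n + j)]) ω ∂μ
      = ∫ ω in U.visit n j, b n / (b n + r j) ∂μ := by
    refine setIntegral_congr_ae (U.measurableSet_visit n j) ?_
    filter_upwards [U.markov (n + j)] with ω hω hv
    have h4 : U.Bl (n + j) ω = n := hv
    have h5 : U.Re (n + j) ω = j := by have := U.Bl_add_Re (n + j) ω; omega
    refine hω.trans ?_
    rw [h4, h5]
  rw [← h1, ← h, h3, setIntegral_const, smul_eq_mul, mul_comm]

/-- The probability that exactly `j` red balls precede the `n`-th blue ball. -/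
noncomputable def hitProb (U : Urn μ b r) : ℕ → ℕ → ℝ
  | 0, j => if j = 0 then 1 else 0
  | n + 1, j => μ.real (U.hit n j)

theorem measureReal_visit (U : Urn μ b r) [IsProbabilityMeasure μ] (hb : ∀ i, 0 < b i)
    (hr : ∀ i, 0 < r i) (n j : ℕ) :
    μ.real (U.visit n j) = U.hitProb (n + 1) j * (1 + r j / b n) := by
  have h1 := hb n
  have h2 := hr j
  rw [hitProb, U.measureReal_hit]
  field_simp

theorem measureReal_visit_zero (U : Urn μ b r) [IsProbabilityMeasure μ] (n : ℕ) :
    μ.real (U.visit n 0) = U.hitProb n 0 := by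
  cases n with
  | zero =>
    have : U.visit 0 0 = Set.univ := by ext ω; simp [visit, U.init_Bl]
    simp [this, hitProb]
  | succ n =>
    rw [hitProb]
    congr 1
    ext ω
    have h1 := U.Bl_succ n ω
    have h2 := U.Bl_le n ω
    simp only [visit, hit, Set.mem_ofPred_eq, add_zero]
    omega

theorem measureReal_visit_succ (U : Urn μ b r) [IsProbabilityMeasure μ] (n j : ℕ) :
    μ.real (U.visit n (j + 1)) =
      U.hitProb n (j + 1) + (μ.real (U.visit n j) - U.hitProb (n + 1) j) := by
  have hd : μ.real (U.visit n j) - U.hitProb (n + 1) j = μ.real (U.visit n j \ U.hit n j) :=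
    (measureReal_sdiff (U.hit_subset_visit n j) (U.measurableSet_hit n j)).symm
  rw [hd]
  cases n with
  | zero =>
    simp only [hitProb, Nat.succ_ne_zero, if_false, zero_add]
    congr 1
    ext ω
    have h1 := U.Bl_succ j ω
    simp only [visit, hit, Set.mem_sdiff, Set.mem_ofPred_eq, zero_add]
    omega
  | succ n =>
    have hdisj : Disjoint (U.hit n (j + 1)) (U.visit (n + 1) j \ U.hit (n + 1) j) := by
      rw [Set.disjoint_left]
      intro ω h1 h2
      have h3 := h1.1
      have h4 : U.Bl (n + 1 + j) ω = n + 1 := h2.1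
      rw [show n + 1 + j = n + (j + 1) by ring] at h4
      omega
    rw [hitProb, ← measureReal_union hdisj
      ((U.measurableSet_visit _ _).diff (U.measurableSet_hit _ _))]
    congr 1
    ext ω
    have h1 := U.Bl_succ (n + (j + 1)) ω
    simp only [visit, hit, Set.mem_union, Set.mem_sdiff, Set.mem_ofPred_eq,
      show n + 1 + (j + 1) = n + (j + 1) + 1 by ring, show n + 1 + j = n + (j + 1) by ring]
    omega

theorem isHitLaw (U : Urn μ b r) [IsProbabilityMeasure μ] (hb : ∀ i, 0 < b i)
    (hr : ∀ i, 0 < r i) (htop : Tendsto (fun j => 1 / r j) atTop atTop) :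
    IsHitLaw (fun j => 1 / r j) (fun n => 1 / b n) U.hitProb where
  nonneg n j := by
    cases n with
    | zero => simp only [hitProb]; split_ifs <;> norm_num
    | succ n => exact measureReal_nonneg
  le_one n j := by
    cases n with
    | zero => simp only [hitProb]; split_ifs <;> norm_num
    | succ n => exact measureReal_le_one
  init j := rfl
  step_zero n := by
    rw [← U.measureReal_visit_zero n, U.measureReal_visit hb hr, div_div_eq_mul_div, div_one,
      one_div_mul_eq_div]
  step_succ n j := by
    have h := U.measureReal_visit_succ n j
    rw [U.measureReal_visit hb hr, U.measureReal_visit hb hr] at h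
    simp only [div_div_eq_mul_div, div_one, one_div_mul_eq_div]
    rw [h]
    ring
  rho_pos j := one_div_pos.2 (hr j)
  s_pos n := one_div_pos.2 (hb n)
  rho_top := htop

theorem hit_unique (U : Urn μ b r) {n j k : ℕ} {ω : Ω} (hj : ω ∈ U.hit n j)
    (hk : ω ∈ U.hit n k) : j = k := by
  have key : ∀ {j k : ℕ}, ω ∈ U.hit n j → ω ∈ U.hit n k → ¬ j < k := by
    intro j k hj hk hlt
    have h1 : U.Bl (n + j + 1) ω ≤ U.Bl (n + k) ω := U.Bl_mono ω (by omega)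
    have h2 := hj.2
    have h3 := hk.1
    omega
  exact le_antisymm (not_lt.1 (key hk hj)) (not_lt.1 (key hj hk))

theorem ae_exists_hit (U : Urn μ b r) [IsProbabilityMeasure μ] (hb : ∀ i, 0 < b i)
    (hr : ∀ i, 0 < r i) (htop : Tendsto (fun j => 1 / r j) atTop atTop) :
    ∀ᵐ ω ∂μ, ∀ n, ∃ j, ω ∈ U.hit n j := by
  refine ae_all_iff.2 fun n => ?_
  have H := U.isHitLaw hb hr htop
  have h1 := H.mean_const (n + 1) 1
  have hs := H.summable (n + 1) (PolyGrowth.const 1)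
  simp only [hitMean, mul_one] at h1 hs
  have h2 : μ (⋃ j, U.hit n j) = 1 := by
    rw [measure_iUnion (fun j k hjk => Set.disjoint_left.2 fun ω hj hk =>
      hjk (U.hit_unique hj hk)) (U.measurableSet_hit n)]
    have h3 := ENNReal.ofReal_tsum_of_nonneg (H.nonneg (n + 1)) hs
    rw [h1, ENNReal.ofReal_one] at h3
    rw [h3]
    refine tsum_congr fun j => ?_
    rw [hitProb, ofReal_measureReal]
  have h4 := (mem_ae_iff_prob_eq_one (MeasurableSet.iUnion (U.measurableSet_hit n))).2 h2
  filter_upwards [h4] with ω hω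
  exact Set.mem_iUnion.1 hω

theorem tau_succ_of_mem_hit_of_lt (U : Urn μ b r) {n j : ℕ} {ω : Ω}
    (h0 : U.Bl (U.tau n ω) ω = n) (hlt : ∀ m < U.tau n ω, U.Bl m ω < n) (hj : ω ∈ U.hit n j) :
    U.tau (n + 1) ω = n + j + 1 := by
  have h1 := hj.1
  have h2 := hj.2
  have h3 : U.tau n ω ≤ n + j := by
    by_contra h
    have := hlt (n + j) (by omega)
    omega
  have hmem : n + j + 1 ∈ {m : ℕ | U.tau n ω < m ∧ U.Bl m ω = U.Bl (m - 1) ω + 1} := by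
    refine ⟨by omega, ?_⟩
    rw [Nat.add_sub_cancel, h1, h2]
  refine le_antisymm (Nat.sInf_le hmem) (le_csInf ⟨_, hmem⟩ fun m hm => ?_)
  by_contra hcon
  have h4 : U.Bl (U.tau n ω) ω ≤ U.Bl (m - 1) ω := U.Bl_mono ω (by have := hm.1; omega)
  have h5 : U.Bl m ω ≤ U.Bl (n + j) ω := U.Bl_mono ω (by omega)
  have := hm.2
  omega

theorem Bl_tau (U : Urn μ b r) {ω : Ω} (h : ∀ n, ∃ j, ω ∈ U.hit n j) (n : ℕ) :
    U.Bl (U.tau n ω) ω = n ∧ ∀ m < U.tau n ω, U.Bl m ω < n := by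
  induction n with
  | zero => exact ⟨U.init_Bl ω, fun m hm => absurd hm (Nat.not_lt_zero m)⟩
  | succ n ih =>
    obtain ⟨j, hj⟩ := h n
    rw [U.tau_succ_of_mem_hit_of_lt ih.1 ih.2 hj]
    refine ⟨hj.2, fun m hm => ?_⟩
    have h5 : U.Bl m ω ≤ U.Bl (n + j) ω := U.Bl_mono ω (by omega)
    have := hj.1
    omega

theorem D_tau_succ (U : Urn μ b r) {n j : ℕ} {ω : Ω} (h : ∀ n, ∃ j, ω ∈ U.hit n j)
    (hj : ω ∈ U.hit n j) : (U.D (U.tau (n + 1) ω) ω : ℝ) = (j : ℝ) - ((n + 1 : ℕ) : ℝ) := by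
  have h1 := U.Bl_tau h n
  rw [U.tau_succ_of_mem_hit_of_lt h1.1 h1.2 hj]
  have h2 := U.Bl_add_Re (n + j + 1) ω
  rw [hj.2] at h2
  rw [D, hj.2, show U.Re (n + j + 1) ω = j by omega]
  push_cast
  ring

theorem integral_D_tau_succ (U : Urn μ b r) [IsProbabilityMeasure μ] (hb : ∀ i, 0 < b i)
    (hr : ∀ i, 0 < r i) (htop : Tendsto (fun j => 1 / r j) atTop atTop) (n : ℕ) :
    ∫ ω, (U.D (U.tau (n + 1) ω) ω : ℝ) ∂μ =
      hitMean U.hitProb (n + 1) (fun j => (j : ℝ)) - ((n + 1 : ℕ) : ℝ) := by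
  have H := U.isHitLaw hb hr htop
  set G : ℕ → Ω → ℝ := fun j =>
    (U.hit n j).indicator fun _ => (j : ℝ) - ((n + 1 : ℕ) : ℝ) with hG
  have hF_int : ∀ j, Integrable (G j) μ := fun j =>
    (integrable_const _).indicator (U.measurableSet_hit n j)
  have hGint : ∀ j, ∫ ω, G j ω ∂μ = U.hitProb (n + 1) j * ((j : ℝ) - ((n + 1 : ℕ) : ℝ)) :=
    fun j => by
      rw [integral_indicator_const _ (U.measurableSet_hit n j), smul_eq_mul, hitProb]
  have hnorm : ∀ j, ∫ ω, ‖G j ω‖ ∂μ = U.hitProb (n + 1) j * |(j : ℝ) - ((n + 1 : ℕ) : ℝ)| :=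
    fun j => by
      simp only [hG, norm_indicator_eq_indicator_norm]
      rw [integral_indicator_const _ (U.measurableSet_hit n j), smul_eq_mul, hitProb,
        Real.norm_eq_abs]
  have hsum : Summable fun j => ∫ ω, ‖G j ω‖ ∂μ := by
    simp only [hnorm]
    exact H.summable (n + 1) (by fun_prop)
  have hae : (fun ω => (U.D (U.tau (n + 1) ω) ω : ℝ)) =ᵐ[μ] fun ω => ∑' j, G j ω := by
    filter_upwards [U.ae_exists_hit hb hr htop] with ω hω
    obtain ⟨j, hj⟩ := hω n
    have hne : ∀ k, k ≠ j → G k ω = 0 := fun k hk =>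
      Set.indicator_of_notMem (fun hk' => hk (U.hit_unique hk' hj)) _
    rw [tsum_eq_single j hne, U.D_tau_succ hω hj]
    exact (Set.indicator_of_mem hj fun _ => (j : ℝ) - ((n + 1 : ℕ) : ℝ)).symm
  rw [integral_congr_ae hae,
    ← (hasSum_integral_of_summable_integral_norm hF_int hsum).tsum_eq]
  simp only [hGint]
  have h := H.mean_sub (n + 1) (φ := fun j => (j : ℝ)) (ψ := fun _ => ((n + 1 : ℕ) : ℝ))
    (by fun_prop) (by fun_prop)
  rwa [H.mean_const] at h

end Urn

theorem mean_discrepancy_at_tau_limit_plus {Ω : Type*} [MeasurableSpace Ω] (μ : MeasureTheory.Measure Ω) [MeasureTheory.IsProbabilityMeasure μ]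
    (α B : ℝ) (hα : 0 < α) (w : ℕ → ℝ) (hw : ∀ n, 0 < w n)
    (hasymp : WeightAsymp w α B)
    (b r : ℕ → ℝ) (hb : ∀ i, 0 < b i) (hr : ∀ i, 0 < r i)
    (hbr : ∀ i, b i = w (2*i+1) ∧ r i = w (2*i)) (U : Urn μ b r) :
    Tendsto (fun n : ℕ => ∫ ω, (U.D (U.tau n ω) ω : ℝ) ∂μ)
      atTop (nhds (1 / (2*(2*α + 1)))) := by
  have htop : Tendsto (fun j => 1 / r j) atTop atTop := by
    simpa only [fun i => (hbr i).2] using hasymp.tendsto_inv_atTop hα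
  have h2 : (0 : ℝ) < 2 ^ α := by positivity
  have Rr := regularRates_of_expansion (x := fun n => 1 / r n) hα h2
    (fun n => one_div_pos.2 (hr n))
    (by simpa only [fun i => (hbr i).2] using hasymp.tendsto_even)
  have Rb := regularRates_of_expansion (x := fun n => 1 / b n) hα h2
    (fun n => one_div_pos.2 (hb n))
    (by simpa only [fun i => (hbr i).1] using hasymp.tendsto_odd)
  have h := (U.isHitLaw hb hr htop).tendsto_mean_sub hα (by positivity) (by positivity) Rr Rb
  rw [← tendsto_add_atTop_iff_nat 1] at h ⊢
  simp only [U.integral_D_tau_succ hb hr htop]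
  convert h using 2
  field_simp
  ring
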